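/- arXiv:1305.6674 — 7 statements merged into one kernel-verified Lean document; each statement's English description precedes it below -/
import Mathlib

section
/- Let S_T be the tangent splash, with centre T, of some order-q-subplane of PG(2,q³) tangent to ℓ∞. Let ℓ be an order-q-subline of PG(2,q³) disjoint from ℓ∞ such that the unique line of PG(2,q³) containing ℓ meets ℓ∞ in a point of S_T ∖ {T}. Then there exists exactly one order-q-subplane of PG(2,q³) that is tangent to ℓ∞, contains ℓ, and has tangent splash S_T. -/
open scoped LinearAlgebra.Projectivization
open Module

noncomputable section

/-- The action of an invertible L-linear map on the points of PG(2,q³) = ℙ L (Fin 3 → L).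
Projectivities of PG(2,q³), i.e. elements of PGL(3,L), are exactly the maps of this form. -/
def actGL3 (L : Type*) [Field L] (g : LinearMap.GeneralLinearGroup L (Fin 3 → L))
    (P : ℙ L (Fin 3 → L)) : ℙ L (Fin 3 → L) :=
  Projectivization.map g.toLinearEquiv.toLinearMap g.toLinearEquiv.injective P

/-- The set of K-rational points {(x:y:z) : (x,y,z) ∈ K³ ∖ {0}} of PG(2,q³). -/
def stdSubplane (K L : Type*) [Field K] [Field L] [Algebra K L] : Set (ℙ L (Fin 3 → L)) :=
  {P | ∃ (v : Fin 3 → K) (h : (fun i => algebraMap K L (v i)) ≠ 0),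
    P = Projectivization.mk L (fun i => algebraMap K L (v i)) h}

/-- The standard subline {(x:y:0) : (x,y) ∈ K² ∖ {0}} of PG(2,q³). -/
def stdSubline (K L : Type*) [Field K] [Field L] [Algebra K L] : Set (ℙ L (Fin 3 → L)) :=
  {P | ∃ (v : Fin 3 → K) (h : (fun i => algebraMap K L (v i)) ≠ 0),
    v 2 = 0 ∧ P = Projectivization.mk L (fun i => algebraMap K L (v i)) h}

/-- An order-q-subplane of PG(2,q³): the image of the set of K-rational points under an
element of PGL(3,L). -/
def IsOSubplane (K L : Type*) [Field K] [Field L] [Algebra K L]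
    (S : Set (ℙ L (Fin 3 → L))) : Prop :=
  ∃ g : LinearMap.GeneralLinearGroup L (Fin 3 → L), S = actGL3 L g '' stdSubplane K L

/-- An order-q-subline of PG(2,q³): the image of the standard subline under an element of
PGL(3,L). -/
def IsOSubline (K L : Type*) [Field K] [Field L] [Algebra K L]
    (S : Set (ℙ L (Fin 3 → L))) : Prop :=
  ∃ g : LinearMap.GeneralLinearGroup L (Fin 3 → L), S = actGL3 L g '' stdSubline K L

/-- The line at infinity ℓ∞ = {(x:y:z) : z = 0} of PG(2,q³). -/
def linfty (L : Type*) [Field L] : Set (ℙ L (Fin 3 → L)) :=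
  {P | P.rep 2 = 0}

/-- The tangent splash of a set B of points of PG(2,q³): the set of points of ℓ∞ lying on a
line of PG(2,q³) spanned by two distinct points of B. -/
def splashOf (L : Type*) [Field L] (Bs : Set (ℙ L (Fin 3 → L))) : Set (ℙ L (Fin 3 → L)) :=
  {P | P ∈ linfty L ∧ ∃ A₁ ∈ Bs, ∃ A₂ ∈ Bs, A₁ ≠ A₂ ∧
    P.submodule ≤ A₁.submodule ⊔ A₂.submodule}

namespace TSplash

def Ind2 {L : Type} [Field L] (u v : Fin 3 → L) : Prop :=
  ∀ a b : L, a • u + b • v = 0 → a = 0 ∧ b = 0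

def Ind3 {L : Type} [Field L] (u v w : Fin 3 → L) : Prop :=
  ∀ a b c : L, a • u + b • v + c • w = 0 → a = 0 ∧ b = 0 ∧ c = 0

/-- `a`, `b` are independent over the image of `f`. -/
def KInd {K L : Type} [Field K] [Field L] (f : K →+* L) (α β : L) : Prop :=
  ∀ x y : K, f x * α + f y * β = 0 → x = 0 ∧ y = 0

def pts {K L : Type} [Field K] [Field L] (f : K →+* L) (u v w : Fin 3 → L) :
    Set (ℙ L (Fin 3 → L)) :=
  {P | ∃ a b c : K, P.submodule = Submodule.span L {f a • u + f b • v + f c • w}}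

def VS {K L : Type} [Field K] [Field L] (f : K →+* L) (α β : L) : Set L :=
  {c | ∃ x y : K, c = f x * α + f y * β}

/-- normal form of a splash -/
def spl {L : Type} [Field L] (p t : Fin 3 → L) (V : Set L) :
    Set (ℙ L (Fin 3 → L)) :=
  {P | P.submodule = Submodule.span L {t} ∨
    ∃ c ∈ V, P.submodule = Submodule.span L {p + c • t}}

section
variable {K L : Type} [Field K] [Field L]

lemma span_eq_iff {v w : Fin 3 → L} :
    Submodule.span L {v} = Submodule.span L {w} ↔ ∃ z : L, z ≠ 0 ∧ z • v = w := by
  rw [Submodule.span_singleton_eq_span_singleton]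
  constructor
  · rintro ⟨z, hz⟩
    exact ⟨z, z.ne_zero, hz⟩
  · rintro ⟨z, h0, hz⟩
    exact ⟨Units.mk0 z h0, hz⟩

lemma exists_pt (v : Fin 3 → L) (h : v ≠ 0) :
    ∃ P : ℙ L (Fin 3 → L), P.submodule = Submodule.span L {v} :=
  ⟨Projectivization.mk L v h, Projectivization.submodule_mk _ _⟩

lemma pt_rep (P : ℙ L (Fin 3 → L)) : ∃ v : Fin 3 → L, v ≠ 0 ∧
    P.submodule = Submodule.span L {v} :=
  ⟨P.rep, P.rep_nonzero, P.submodule_eq⟩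

lemma pt_ne {P : ℙ L (Fin 3 → L)} {v : Fin 3 → L} (h : P.submodule = Submodule.span L {v}) :
    v ≠ 0 := by
  rintro rfl
  rw [P.submodule_eq, span_eq_iff] at h
  obtain ⟨z, hz, h⟩ := h
  exact P.rep_nonzero ((smul_eq_zero.1 h).resolve_left hz)

lemma pt_ext {P Q : ℙ L (Fin 3 → L)} (h : P.submodule = Q.submodule) : P = Q :=
  Projectivization.submodule_injective h

lemma mem_linfty {P : ℙ L (Fin 3 → L)} {v : Fin 3 → L}
    (h : P.submodule = Submodule.span L {v}) : P ∈ linfty L ↔ v 2 = 0 := by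
  rw [P.submodule_eq, span_eq_iff] at h
  obtain ⟨z, hz, rfl⟩ := h
  simp [linfty, hz]

lemma mk_eq_iff {P : ℙ L (Fin 3 → L)} {v : Fin 3 → L} (h : v ≠ 0) :
    P = Projectivization.mk L v h ↔ P.submodule = Submodule.span L {v} := by
  constructor
  · rintro rfl; exact Projectivization.submodule_mk _ _
  · intro h'; exact pt_ext (h'.trans (Projectivization.submodule_mk _ _).symm)

lemma mem_splash {P : ℙ L (Fin 3 → L)} {v : Fin 3 → L}
    (h : P.submodule = Submodule.span L {v}) {B : Set (ℙ L (Fin 3 → L))} :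
    P ∈ splashOf L B ↔ v 2 = 0 ∧ ∃ A₁ ∈ B, ∃ A₂ ∈ B, A₁ ≠ A₂ ∧
      v ∈ A₁.submodule ⊔ A₂.submodule := by
  simp only [splashOf, Set.mem_ofPred_eq, mem_linfty h, h, Submodule.span_singleton_le_iff_mem]

/-- Quadratic relations are trivial. -/
lemma quad [Algebra K L] (hdim : Module.finrank K L = 3) {α β : L}
    (h : KInd (algebraMap K L) α β) (x y z : K)
    (e : algebraMap K L x * α ^ 2 + algebraMap K L y * (α * β) + algebraMap K L z * β ^ 2 = 0) :
    x = 0 ∧ y = 0 ∧ z = 0 := by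
  have hβ : β ≠ 0 := by
    rintro rfl
    have := h 0 1 (by simp)
    simp at this
  have : FiniteDimensional K L := FiniteDimensional.of_finrank_pos (by omega)
  set t := α / β with ht
  have hα : α = t * β := by rw [ht]; field_simp
  have hint : IsIntegral K t := IsIntegral.of_finite K t
  have e2 : algebraMap K L x * t ^ 2 + algebraMap K L y * t + algebraMap K L z = 0 := by
    have : (algebraMap K L x * t ^ 2 + algebraMap K L y * t + algebraMap K L z) * β ^ 2 = 0 := by
      rw [hα] at e; linear_combination e
    exact (mul_eq_zero.1 this).resolve_right (pow_ne_zero _ hβ)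
  have hdeg : (minpoly K t).natDegree = 3 := by
    have h1 := minpoly.degree_dvd (K := K) hint
    rw [hdim] at h1
    rcases (Nat.dvd_prime Nat.prime_three).1 h1 with h1 | h1
    · exfalso
      rw [minpoly.natDegree_eq_one_iff] at h1
      obtain ⟨k, hk⟩ := h1
      have := h 1 (-k) (by rw [hα, ← hk]; simp)
      simp at this
    · exact h1
  set p : Polynomial K := Polynomial.C x * Polynomial.X ^ 2 + Polynomial.C y * Polynomial.X
    + Polynomial.C z with hp
  have hp0 : p = 0 := by
    by_contra hne
    have h1 := minpoly.degree_le_of_ne_zero K t hne (by simpa [hp] using e2)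
    have h2 : p.degree ≤ 2 := Polynomial.degree_quadratic_le
    have h3 := Polynomial.natDegree_le_of_degree_le (n := 2) (h1.trans h2)
    omega
  refine ⟨?_, ?_, ?_⟩
  · have := congrArg (fun r => Polynomial.coeff r 2) hp0
    simpa [hp, Polynomial.coeff_X, Polynomial.coeff_C] using this
  · have := congrArg (fun r => Polynomial.coeff r 1) hp0
    simpa [hp, Polynomial.coeff_X, Polynomial.coeff_C] using this
  · have := congrArg (fun r => Polynomial.coeff r 0) hp0
    simpa [hp, Polynomial.coeff_X, Polynomial.coeff_C] using this

/-- Any two 2-dimensional K-subspaces are proportional. -/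
lemma exists_scale [Algebra K L] (hdim : Module.finrank K L = 3) {α β α' β' : L}
    (h : KInd (algebraMap K L) α β) (h' : KInd (algebraMap K L) α' β') :
    ∃ s : L, s ≠ 0 ∧ ∃ a b c d : K, s * α = algebraMap K L a * α' + algebraMap K L b * β' ∧
      s * β = algebraMap K L c * α' + algebraMap K L d * β' := by
  have : FiniteDimensional K L := FiniteDimensional.of_finrank_pos (by omega)
  let V : Submodule K L := Submodule.span K {α', β'}
  have hli : LinearIndependent K ![α', β'] := by
    rw [LinearIndependent.pair_iff]
    intro x y hxy
    exact h' x y (by simpa [Algebra.smul_def] using hxy)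
  have hV : Module.finrank K V = 2 := by
    have := finrank_span_eq_card hli
    rw [show Set.range ![α', β'] = {α', β'} by simp [Matrix.range_cons, Set.pair_comm]] at this
    simpa [V] using this
  have hq : Module.finrank K (L ⧸ V) = 1 := by
    have := V.finrank_quotient_add_finrank
    omega
  let F : L →ₗ[K] (L ⧸ V) × (L ⧸ V) :=
    (V.mkQ ∘ₗ LinearMap.mulRight K α).prod (V.mkQ ∘ₗ LinearMap.mulRight K β)
  have hF : LinearMap.ker F ≠ ⊥ := by
    apply LinearMap.ker_ne_bot_of_finrank_lt
    rw [Module.finrank_prod, hq, hdim]; norm_num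
  obtain ⟨s, hs, hs0⟩ := (Submodule.ne_bot_iff _).1 hF
  have hs' : s * α ∈ V ∧ s * β ∈ V := by
    simpa [F] using hs
  obtain ⟨⟨a, b, h1⟩, ⟨c, d, h2⟩⟩ := And.intro (Submodule.mem_span_pair.1 hs'.1)
    (Submodule.mem_span_pair.1 hs'.2)
  exact ⟨s, hs0, a, b, c, d, by simpa [Algebra.smul_def] using h1.symm,
    by simpa [Algebra.smul_def] using h2.symm⟩

lemma zero_of_mul {s x : L} (hs : s ≠ 0) (h : s * x = 0) : x = 0 :=
  (mul_eq_zero.1 h).resolve_left hs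

lemma VS_add {f : K →+* L} {α β c d : L} (hc : c ∈ VS f α β) (hd : d ∈ VS f α β) :
    c + d ∈ VS f α β := by
  obtain ⟨x, y, rfl⟩ := hc
  obtain ⟨x', y', rfl⟩ := hd
  exact ⟨x + x', y + y', by simp only [map_add]; ring⟩

lemma VS_sub {f : K →+* L} {α β c d : L} (hc : c ∈ VS f α β) (hd : d ∈ VS f α β) :
    c - d ∈ VS f α β := by
  obtain ⟨x, y, rfl⟩ := hc
  obtain ⟨x', y', rfl⟩ := hd
  exact ⟨x - x', y - y', by simp only [map_sub]; ring⟩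

lemma KInd.ne_left {f : K →+* L} {α β : L} (h : KInd f α β) : α ≠ 0 := by
  rintro rfl
  have := h 1 0 (by simp)
  simp at this

lemma KInd.ne_right {f : K →+* L} {α β : L} (h : KInd f α β) : β ≠ 0 := by
  rintro rfl
  have := h 0 1 (by simp)
  simp at this

lemma exists_scale' [Algebra K L] (hdim : Module.finrank K L = 3) {α β α' β' : L}
    (h : KInd (algebraMap K L) α β) (h' : KInd (algebraMap K L) α' β') :
    ∃ s : L, s ≠ 0 ∧ ∀ c, c ∈ VS (algebraMap K L) α β ↔ s * c ∈ VS (algebraMap K L) α' β' := by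
  obtain ⟨s, hs, a, b, c, d, h1, h2⟩ := exists_scale hdim h h'
  refine ⟨s, hs, fun e => ⟨?_, ?_⟩⟩
  · rintro ⟨x, y, rfl⟩
    refine ⟨x * a + y * c, x * b + y * d, ?_⟩
    simp only [map_add, map_mul]
    linear_combination (algebraMap K L x) * h1 + (algebraMap K L y) * h2
  · rintro ⟨x, y, hxy⟩
    by_cases hD : a * d - b * c = 0
    · exfalso
      have hD' := congrArg (algebraMap K L) hD
      simp only [map_sub, map_mul, map_zero] at hD'
      have e1 := h d (-b) (by
        apply zero_of_mul hs
        simp only [map_neg]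
        linear_combination (algebraMap K L d) * h1 - (algebraMap K L b) * h2 + α' * hD')
      have e2 := h c (-a) (by
        apply zero_of_mul hs
        simp only [map_neg]
        linear_combination (algebraMap K L c) * h1 - (algebraMap K L a) * h2 - β' * hD')
      have ha : a = 0 := neg_eq_zero.1 e2.2
      have hb : b = 0 := neg_eq_zero.1 e1.2
      simp [ha, hb, hs, h.ne_left] at h1
    · have hD' : algebraMap K L (a * d - b * c) ≠ 0 := by
        rw [Ne, map_eq_zero]; exact hD
      refine ⟨(x * d - y * c) / (a * d - b * c), (y * a - x * b) / (a * d - b * c), ?_⟩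
      rw [map_div₀, map_div₀]
      rw [mul_comm s e] at hxy
      have : e * s * algebraMap K L (a * d - b * c)
         = (s * α) * algebraMap K L (x * d - y * c)
         + (s * β) * algebraMap K L (y * a - x * b) := by
        rw [h1, h2, hxy]; simp only [map_sub, map_mul]; ring
      generalize algebraMap K L (a * d - b * c) = D at this hD'
      field_simp
      apply mul_left_cancel₀ hs
      linear_combination this

lemma mul_stable [Algebra K L] (hdim : Module.finrank K L = 3) {α β : L}
    (h : KInd (algebraMap K L) α β) (m : L)
    (hm : ∀ c ∈ VS (algebraMap K L) α β, m * c ∈ VS (algebraMap K L) α β) :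
    ∃ k : K, m = algebraMap K L k := by
  obtain ⟨a, b, h1⟩ := hm α ⟨1, 0, by simp⟩
  obtain ⟨c, d, h2⟩ := hm β ⟨0, 1, by simp⟩
  have := quad hdim h c (d - a) (-b) (by
    simp only [map_sub, map_neg]
    linear_combination β * h1 - α * h2)
  have hb : b = 0 := neg_eq_zero.1 this.2.2
  refine ⟨a, mul_right_cancel₀ h.ne_left ?_⟩
  simpa [hb] using h1

lemma inv_absurd [Algebra K L] (hdim : Module.finrank K L = 3) {α β α' β' κ : L}
    (h : KInd (algebraMap K L) α β) (hκ : κ ≠ 0)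
    (H : ∀ c ∈ VS (algebraMap K L) α β, c ≠ 0 → ∃ e ∈ VS (algebraMap K L) α' β', e * c = κ) :
    False := by
  have hαβ : α + β ≠ 0 := by
    intro h0
    have := h 1 1 (by simpa using h0)
    simp at this
  have hα := h.ne_left
  have hβ := h.ne_right
  obtain ⟨_, ⟨x1, y1, rfl⟩, h1⟩ := H α ⟨1, 0, by simp⟩ hα
  obtain ⟨_, ⟨x2, y2, rfl⟩, h2⟩ := H β ⟨0, 1, by simp⟩ hβ
  obtain ⟨_, ⟨x3, y3, rfl⟩, h3⟩ := H (α + β) ⟨1, 1, by simp⟩ hαβ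
  have hD : x1 * y2 - x2 * y1 = 0 := by
    have r := (quad hdim h (x3 * y1 - x1 * y3)
      ((x2 * y3 - x3 * y2) + (x3 * y1 - x1 * y3) + (x1 * y2 - x2 * y1)) (x2 * y3 - x3 * y2) (by
      apply zero_of_mul hκ
      simp only [map_sub, map_mul, map_add]
      set f := algebraMap K L
      linear_combination (-(f x2 * f y3 - f x3 * f y2) * β * (α + β)) * h1
        - ((f x3 * f y1 - f x1 * f y3) * α * (α + β)) * h2
        - ((f x1 * f y2 - f x2 * f y1) * α * β) * h3))
    obtain ⟨r1, r2, r3⟩ := r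
    linear_combination r2 - r1 - r3
  have hD' := congrArg (algebraMap K L) hD
  simp only [map_sub, map_mul, map_zero] at hD'
  set f := algebraMap K L
  have e1 := h (-y1) y2 (by
    apply zero_of_mul hκ
    simp only [map_neg]
    linear_combination (f y1 * α) * h2 - (f y2 * β) * h1 + α * β * α' * hD')
  have e2 := h (-x1) x2 (by
    apply zero_of_mul hκ
    simp only [map_neg]
    linear_combination (f x1 * α) * h2 - (f x2 * β) * h1 - α * β * β' * hD')
  have hx : x1 = 0 := neg_eq_zero.1 e2.1
  have hy : y1 = 0 := neg_eq_zero.1 e1.1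
  apply hκ
  rw [← h1, hx, hy]; simp

lemma add_smul_ne {p t : Fin 3 → L} (h : Ind2 p t) (c : L) : p + c • t ≠ 0 := by
  intro h0
  have := h 1 c (by simpa using h0)
  simp at this

lemma ind_right_ne {p t : Fin 3 → L} (h : Ind2 p t) : t ≠ 0 := by
  rintro rfl
  have := h 0 1 (by simp)
  simp at this

lemma ind2_eq {p t : Fin 3 → L} (h : Ind2 p t) {a b a' b' : L}
    (e : a • p + b • t = a' • p + b' • t) : a = a' ∧ b = b' := by
  have := h (a - a') (b - b') (by
    rw [sub_smul, sub_smul]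
    linear_combination (norm := module) e)
  exact ⟨sub_eq_zero.1 this.1, sub_eq_zero.1 this.2⟩

lemma centre_unique [Algebra K L] (hdim : Module.finrank K L = 3) {α β α' β' : L}
    (h : KInd (algebraMap K L) α β) {p t p' t' : Fin 3 → L}
    (hpt : Ind2 p t) (hpt' : Ind2 p' t')
    (H : spl p t (VS (algebraMap K L) α β) = spl p' t' (VS (algebraMap K L) α' β')) :
    Submodule.span L {t} = Submodule.span L {t'} := by
  by_contra hne
  obtain ⟨P, hP⟩ := exists_pt t (ind_right_ne hpt)
  obtain ⟨P', hP'⟩ := exists_pt t' (ind_right_ne hpt')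
  have h1 : P ∈ spl p' t' (VS (algebraMap K L) α' β') := H ▸ Or.inl hP
  have h2 : P' ∈ spl p t (VS (algebraMap K L) α β) := H ▸ Or.inl hP'
  rcases h1 with h1 | ⟨c0', hc0', h1⟩
  · exact hne (hP.symm.trans h1)
  rcases h2 with h2 | ⟨c0, hc0, h2⟩
  · exact hne (h2.symm.trans hP')
  obtain ⟨z, hz, h1⟩ := span_eq_iff.1 (hP.symm.trans h1)
  obtain ⟨y, hy, h2⟩ := span_eq_iff.1 (hP'.symm.trans h2)
  have hind : Ind2 t t' := by
    intro a b hab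
    have := hpt b (y * a + b * c0) (by
      have : y • (a • t + b • t') = b • (y • t') + (y * a) • t := by module
      rw [hab, h2] at this
      linear_combination (norm := module) -this)
    obtain ⟨hb, ha⟩ := this
    refine ⟨?_, hb⟩
    simpa [hb, hy] using ha
  refine inv_absurd hdim h (κ := z * y) (mul_ne_zero hz hy) (α' := α') (β' := β') ?_
  intro c hc hc0n
  obtain ⟨Q, hQ⟩ := exists_pt _ (add_smul_ne hpt (c0 + c))
  have hQ' : Q ∈ spl p' t' (VS (algebraMap K L) α' β') := H ▸ Or.inr ⟨_, VS_add hc0 hc, hQ⟩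
  have e0 : p + (c0 + c) • t = c • t + y • t' := by rw [h2]; module
  rw [e0] at hQ
  rcases hQ' with h3 | ⟨e, he, h3⟩
  · exfalso
    obtain ⟨m, hm, h3⟩ := span_eq_iff.1 (hQ.symm.trans h3)
    have := ind2_eq hind (a := m * c) (b := m * y) (a' := 0) (b' := 1)
      (by linear_combination (norm := module) h3)
    simp [hm, hc0n] at this
  · obtain ⟨m, hm, h3⟩ := span_eq_iff.1 (hQ.symm.trans h3)
    have e1 : p' + e • t' = z • t + (e - c0') • t' := by rw [h1]; module
    rw [e1] at h3
    have := ind2_eq hind (a := m * c) (b := m * y) (a' := z) (b' := e - c0')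
      (by linear_combination (norm := module) h3)
    refine ⟨e - c0', VS_sub he hc0', ?_⟩
    rw [← this.1, ← this.2]; ring

lemma ind3_ind2 {u v t : Fin 3 → L} (h : Ind3 u v t) {α β : L} (hβ : β ≠ 0) :
    Ind2 (β • u - α • v) t := by
  intro a b hab
  have := h (a * β) (-(a * α)) b (by linear_combination (norm := module) hab)
  refine ⟨?_, this.2.2⟩
  simpa [hβ] using this.1

lemma ind3_ne {u v t : Fin 3 → L} (h : Ind3 u v t) : t ≠ 0 := by
  rintro rfl
  have := h 0 0 1 (by simp)
  simp at this

lemma ind3_comb_ne {f : K →+* L} {u v t : Fin 3 → L} (h : Ind3 u v t) {a b c : K}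
    (h0 : a ≠ 0 ∨ b ≠ 0 ∨ c ≠ 0) : f a • u + f b • v + f c • t ≠ 0 := by
  intro e
  have := h _ _ _ e
  simp only [map_eq_zero] at this
  tauto

lemma splash_pts {f : K →+* L} {u v t : Fin 3 → L} (h : Ind3 u v t) (ht : t 2 = 0)
    (hk : KInd f (u 2) (v 2)) :
    splashOf L (pts f u v t) = spl (v 2 • u - u 2 • v) t (VS f (u 2) (v 2)) := by
  ext P
  constructor
  · intro hP
    obtain ⟨w, hw0, hw⟩ := pt_rep P
    rw [mem_splash hw] at hP
    obtain ⟨hw2, A, ⟨a1, b1, c1, hA⟩, A', ⟨a2, b2, c2, hA'⟩, -, hmem⟩ := hP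
    rw [hA, hA', ← Submodule.span_union, Set.singleton_union, Submodule.mem_span_pair] at hmem
    obtain ⟨l, m, rfl⟩ := hmem
    have hlm : l * (f a1 * u 2 + f b1 * v 2) + m * (f a2 * u 2 + f b2 * v 2) = 0 := by
      simpa [ht, mul_add] using hw2
    by_cases hD : a1 * b2 - a2 * b1 = 0
    · left
      have key : l * f a1 + m * f a2 = 0 ∧ l * f b1 + m * f b2 = 0 := by
        have hD' := congrArg f hD
        simp only [map_sub, map_mul, map_zero] at hD'
        by_cases h1 : a1 = 0 ∧ b1 = 0
        · by_cases h2 : a2 = 0 ∧ b2 = 0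
          · simp [h1, h2]
          · have hs : f a2 * u 2 + f b2 * v 2 ≠ 0 := fun e => h2 (hk _ _ e)
            have hm : m = 0 := by simpa [h1, hs] using hlm
            simp [h1, hm]
        · have hs : f a1 * u 2 + f b1 * v 2 ≠ 0 := fun e => h1 (hk _ _ e)
          constructor
          · apply zero_of_mul hs
            linear_combination f a1 * hlm - m * v 2 * hD'
          · apply zero_of_mul hs
            linear_combination f b1 * hlm + m * u 2 * hD'
      have e : l • (f a1 • u + f b1 • v + f c1 • t) + m • (f a2 • u + f b2 • v + f c2 • t)
          = (l * f c1 + m * f c2) • t := by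
        have e : l • (f a1 • u + f b1 • v + f c1 • t) + m • (f a2 • u + f b2 • v + f c2 • t)
          = (l * f a1 + m * f a2) • u + (l * f b1 + m * f b2) • v + (l * f c1 + m * f c2) • t := by
          module
        rw [e, key.1, key.2]; simp
      rw [e] at hw hw0
      rw [hw]
      have hn : l * f c1 + m * f c2 ≠ 0 := fun e => hw0 (by rw [e, zero_smul])
      exact (span_eq_iff.2 ⟨_, hn, rfl⟩).symm
    · right
      have hD' : f (a1 * b2 - a2 * b1) ≠ 0 := by rw [Ne, map_eq_zero]; exact hD
      have h1 : ¬ (a1 = 0 ∧ b1 = 0) := by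
        rintro ⟨rfl, rfl⟩; simp at hD
      have hs : f a1 * u 2 + f b1 * v 2 ≠ 0 := fun e => h1 (hk _ _ e)
      set s := f a1 * u 2 + f b1 * v 2 with hs'
      set n := -m / s with hn
      have hm : m = - n * s := by rw [hn]; field_simp
      have hl : l = n * (f a2 * u 2 + f b2 * v 2) := by
        apply mul_right_cancel₀ hs
        linear_combination hlm - (f a2 * u 2 + f b2 * v 2) * hm
      refine ⟨_, ⟨(a2 * c1 - a1 * c2) / (a1 * b2 - a2 * b1),
        (b2 * c1 - b1 * c2) / (a1 * b2 - a2 * b1), rfl⟩, ?_⟩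
      have e : l • (f a1 • u + f b1 • v + f c1 • t) + m • (f a2 • u + f b2 • v + f c2 • t)
          = (n * f (a1 * b2 - a2 * b1)) • (v 2 • u - u 2 • v +
            (f ((a2 * c1 - a1 * c2) / (a1 * b2 - a2 * b1)) * u 2 +
              f ((b2 * c1 - b1 * c2) / (a1 * b2 - a2 * b1)) * v 2) • t) := by
        rw [hl, hm, map_div₀, map_div₀, hs']
        have e2 : (n * f (a1 * b2 - a2 * b1)) • (v 2 • u - u 2 • v +
            (f (a2 * c1 - a1 * c2) / f (a1 * b2 - a2 * b1) * u 2 +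
              f (b2 * c1 - b1 * c2) / f (a1 * b2 - a2 * b1) * v 2) • t) =
            (n * f (a1 * b2 - a2 * b1)) • (v 2 • u - u 2 • v) + (n *
            (f (a2 * c1 - a1 * c2) * u 2 + f (b2 * c1 - b1 * c2) * v 2)) • t := by
          rw [smul_add, smul_smul]
          congr 2
          generalize f (a1 * b2 - a2 * b1) = D at hD'
          field_simp
        rw [e2]
        simp only [map_sub, map_mul]
        module
      rw [e] at hw hw0
      rw [hw]
      exact (span_eq_iff.2 ⟨_, fun e => hw0 (by rw [e, zero_smul]), rfl⟩).symm
  · rintro (hP | ⟨_, ⟨x, y, rfl⟩, hP⟩)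
    · rw [mem_splash hP]
      have hne : f 1 • u + f 0 • v + f 0 • t ≠ 0 := ind3_comb_ne h (by simp)
      obtain ⟨Q, hQ⟩ := exists_pt _ hne
      refine ⟨ht, P, ⟨0, 0, 1, by simpa using hP⟩, Q, ⟨1, 0, 0, hQ⟩, ?_, ?_⟩
      · rintro rfl
        obtain ⟨z, hz, e⟩ := span_eq_iff.1 (hP.symm.trans hQ)
        have := h (-1) 0 z (by
          simp only [map_one, map_zero] at e
          linear_combination (norm := module) e)
        simp at this
      · rw [hP]
        exact Submodule.mem_sup_left (Submodule.mem_span_singleton_self _)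
    · rw [mem_splash hP]
      obtain ⟨Q, hQ⟩ := exists_pt _ (ind3_comb_ne (f := f) h (a := 1) (b := 0) (c := y) (by simp))
      obtain ⟨R, hR⟩ := exists_pt _ (ind3_comb_ne (f := f) h (a := 0) (b := 1) (c := -x) (by simp))
      refine ⟨?_, Q, ⟨_, _, _, hQ⟩, R, ⟨_, _, _, hR⟩, ?_, ?_⟩
      · simp [ht]; ring
      · rintro rfl
        obtain ⟨z, hz, e⟩ := span_eq_iff.1 (hQ.symm.trans hR)
        have := h z (-1) (z * f y + f x) (by
          simp only [map_one, map_zero, map_neg] at e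
          linear_combination (norm := module) e)
        simp at this
      · rw [hQ, hR, ← Submodule.span_union, Set.singleton_union, Submodule.mem_span_pair]
        refine ⟨v 2, - u 2, ?_⟩
        simp only [map_one, map_zero, map_neg]
        module

lemma pts_tangent {f : K →+* L} {u v t : Fin 3 → L} (h : Ind3 u v t) (ht : t 2 = 0)
    (hk : KInd f (u 2) (v 2)) {P : ℙ L (Fin 3 → L)} (hP : P.submodule = Submodule.span L {t}) :
    pts f u v t ∩ linfty L = {P} := by
  ext Q
  constructor
  · rintro ⟨⟨a, b, c, hQ⟩, hQ2⟩
    rw [mem_linfty hQ] at hQ2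
    have hne := pt_ne hQ
    have := hk a b (by simpa [ht] using hQ2)
    simp only [this, map_zero, zero_smul, zero_add] at hQ hne
    refine pt_ext (Eq.trans ?_ hP.symm)
    rw [hQ]
    exact (span_eq_iff.2 ⟨_, fun e => hne (by rw [e, zero_smul]), rfl⟩).symm
  · rintro rfl
    exact ⟨⟨0, 0, 1, by simpa using hP⟩, (mem_linfty hP).2 ht⟩

lemma kind_of_tangent {f : K →+* L} {u v t : Fin 3 → L} (h : Ind3 u v t)
    {P : ℙ L (Fin 3 → L)} (hP : P.submodule = Submodule.span L {t})
    (hB : pts f u v t ∩ linfty L = {P}) : KInd f (u 2) (v 2) := by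
  intro a b hab
  by_contra hne
  have hne' : f a • u + f b • v + f 0 • t ≠ 0 := ind3_comb_ne h (by tauto)
  obtain ⟨Q, hQ⟩ := exists_pt _ hne'
  have : Q ∈ pts f u v t ∩ linfty L := ⟨⟨_, _, _, hQ⟩, (mem_linfty hQ).2 (by simpa using hab)⟩
  rw [hB] at this
  obtain rfl : Q = P := this
  obtain ⟨z, hz, e⟩ := span_eq_iff.1 (hP.symm.trans hQ)
  have := h (f a) (f b) (-z) (by
    simp only [map_zero] at e
    linear_combination (norm := module) -e)
  exact hz (neg_eq_zero.1 this.2.2)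

lemma pts_scale {f : K →+* L} {u v t : Fin 3 → L} {m : L} (hm : m ≠ 0) :
    pts f (m • u) (m • v) (m • t) = pts f u v t := by
  have key : ∀ a b c : K, Submodule.span L {f a • m • u + f b • m • v + f c • m • t} =
      Submodule.span L {f a • u + f b • v + f c • t} := by
    intro a b c
    refine (span_eq_iff.2 ⟨m, hm, ?_⟩).symm
    module
  ext P
  simp only [pts, key]

lemma mem_spanK [Algebra K L] {u v t x : Fin 3 → L} : x ∈ Submodule.span K {u, v, t} ↔
    ∃ a b c : K, algebraMap K L a • u + algebraMap K L b • v + algebraMap K L c • t = x := by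
  rw [Submodule.mem_span_triple]
  simp only [algebraMap_smul]

lemma pts_congr [Algebra K L] {u v t u' v' t' : Fin 3 → L} (h : Ind3 u v t)
    (hk : ∀ a b c : K, algebraMap K L a • u' + algebraMap K L b • v' + algebraMap K L c • t' = 0 →
      a = 0 ∧ b = 0 ∧ c = 0)
    (hu : u' ∈ Submodule.span K {u, v, t}) (hv : v' ∈ Submodule.span K {u, v, t})
    (ht : t' ∈ Submodule.span K {u, v, t}) :
    Ind3 u' v' t' ∧ pts (algebraMap K L) u v t = pts (algebraMap K L) u' v' t' := by
  have hr : ∀ (a b c : Fin 3 → L), Set.range ![a, b, c] = {a, b, c} := by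
    intro a b c
    ext x
    simp [eq_comm]
    tauto
  have hli : LinearIndependent K ![u', v', t'] := by
    rw [Fintype.linearIndependent_iff]
    intro g hg
    simp only [Fin.sum_univ_three, Matrix.cons_val_zero, Matrix.cons_val_one,
      Matrix.cons_val] at hg
    have := hk (g 0) (g 1) (g 2) (by simpa only [algebraMap_smul] using hg)
    intro i
    fin_cases i
    exacts [this.1, this.2.1, this.2.2]
  have hle : Submodule.span K {u', v', t'} ≤ Submodule.span K {u, v, t} := by
    rw [Submodule.span_le]
    rintro x (rfl | rfl | rfl)
    exacts [hu, hv, ht]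
  have h1 : Module.finrank K (Submodule.span K {u', v', t'}) = 3 := by
    have := finrank_span_eq_card hli
    rw [hr] at this
    simpa using this
  have h2 : Module.finrank K (Submodule.span K {u, v, t}) ≤ 3 := by
    have := finrank_range_le_card (R := K) ![u, v, t]
    rw [Set.finrank, hr] at this
    simpa using this
  have : FiniteDimensional K (Submodule.span K {u, v, t}) :=
    FiniteDimensional.span_of_finite K (by simp)
  have heq := Submodule.eq_of_le_of_finrank_le hle (by omega)
  have hmem : ∀ x, (∃ a b c : K, algebraMap K L a • u + algebraMap K L b • v +
      algebraMap K L c • t = x) ↔ (∃ a b c : K, algebraMap K L a • u' + algebraMap K L b • v' +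
      algebraMap K L c • t' = x) := by
    intro x
    rw [← mem_spanK, ← mem_spanK, heq]
  constructor
  · have hli2 : LinearIndependent L ![u, v, t] := by
      rw [Fintype.linearIndependent_iff]
      intro g hg
      simp only [Fin.sum_univ_three, Matrix.cons_val_zero, Matrix.cons_val_one,
        Matrix.cons_val] at hg
      have := h (g 0) (g 1) (g 2) hg
      intro i
      fin_cases i
      exacts [this.1, this.2.1, this.2.2]
    have htop := hli2.span_eq_top_of_card_eq_finrank (by simp)
    have hK : ∀ x ∈ Submodule.span K {u, v, t}, x ∈ Submodule.span L {u', v', t'} := by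
      intro x hx
      rw [← heq, mem_spanK] at hx
      obtain ⟨a, b, c, rfl⟩ := hx
      rw [Submodule.mem_span_triple]
      exact ⟨_, _, _, rfl⟩
    have htop' : ⊤ ≤ Submodule.span L (Set.range ![u', v', t']) := by
      rw [← htop, hr, hr, Submodule.span_le]
      intro x hx
      exact hK x (Submodule.subset_span hx)
    have hli3 := linearIndependent_of_top_le_span_of_card_eq_finrank htop' (by simp)
    rw [Fintype.linearIndependent_iff] at hli3
    intro a b c habc
    have := hli3 ![a, b, c] (by simpa [Fin.sum_univ_three] using habc)
    exact ⟨this 0, this 1, this 2⟩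
  · ext P
    constructor
    · rintro ⟨a, b, c, hP⟩
      obtain ⟨a', b', c', e⟩ := (hmem _).1 ⟨a, b, c, rfl⟩
      exact ⟨a', b', c', by rw [hP, e]⟩
    · rintro ⟨a, b, c, hP⟩
      obtain ⟨a', b', c', e⟩ := (hmem _).2 ⟨a, b, c, rfl⟩
      exact ⟨a', b', c', by rw [hP, e]⟩

lemma act_submodule (g : LinearMap.GeneralLinearGroup L (Fin 3 → L)) {P : ℙ L (Fin 3 → L)}
    {v : Fin 3 → L} (h : P.submodule = Submodule.span L {v}) :
    (actGL3 L g P).submodule = Submodule.span L {g.toLinearEquiv v} := by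
  have hv := pt_ne h
  obtain rfl := (mk_eq_iff hv).2 h
  rw [actGL3, Projectivization.map_mk, Projectivization.submodule_mk]
  rfl

lemma vec_expand (f : K →+* L) (g : LinearMap.GeneralLinearGroup L (Fin 3 → L)) (v : Fin 3 → K) :
    g.toLinearEquiv (fun i => f (v i)) = f (v 0) • g.toLinearEquiv (Pi.single 0 1) +
      f (v 1) • g.toLinearEquiv (Pi.single 1 1) + f (v 2) • g.toLinearEquiv (Pi.single 2 1) := by
  rw [← map_smul, ← map_smul, ← map_smul, ← map_add, ← map_add]
  congr 1
  funext i
  fin_cases i <;> simp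

lemma vec_ne {f : K →+* L} {v : Fin 3 → K} (hv : v ≠ 0) : (fun i => f (v i)) ≠ 0 := by
  intro h
  apply hv
  funext i
  simpa using congrFun h i

lemma image_std [Algebra K L] (g : LinearMap.GeneralLinearGroup L (Fin 3 → L)) :
    actGL3 L g '' stdSubplane K L = pts (algebraMap K L) (g.toLinearEquiv (Pi.single 0 1))
      (g.toLinearEquiv (Pi.single 1 1)) (g.toLinearEquiv (Pi.single 2 1)) := by
  ext P
  constructor
  · rintro ⟨Q, ⟨v, hv, hQ⟩, rfl⟩
    rw [mk_eq_iff] at hQ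
    refine ⟨v 0, v 1, v 2, ?_⟩
    rw [act_submodule g hQ, vec_expand]
  · rintro ⟨a, b, c, hP⟩
    have hne := pt_ne hP
    have hx := vec_expand (algebraMap K L) g ![a, b, c]
    simp only [Matrix.cons_val_zero, Matrix.cons_val_one, Matrix.cons_val] at hx
    rw [← hx] at hP hne
    have hne' : (fun i => algebraMap K L (![a, b, c] i)) ≠ 0 := by
      intro h; rw [h] at hne; simp at hne
    refine ⟨_, ⟨_, hne', rfl⟩, ?_⟩
    exact pt_ext ((act_submodule g (Projectivization.submodule_mk _ _)).trans hP.symm)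

lemma subline_nf [Algebra K L] {S : Set (ℙ L (Fin 3 → L))} (h : IsOSubline K L S) :
    ∃ w₁ w₂ : Fin 3 → L, Ind2 w₁ w₂ ∧ ∀ P, P ∈ S ↔ ∃ a b : K,
      P.submodule = Submodule.span L {algebraMap K L a • w₁ + algebraMap K L b • w₂} := by
  obtain ⟨g, rfl⟩ := h
  refine ⟨g.toLinearEquiv (Pi.single 0 1), g.toLinearEquiv (Pi.single 1 1), ?_, ?_⟩
  · intro a b hab
    rw [← map_smul, ← map_smul, ← map_add, map_eq_zero_iff _ g.toLinearEquiv.injective] at hab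
    have h0 := congrFun hab 0
    have h1 := congrFun hab 1
    simp at h0 h1
    exact ⟨h0, h1⟩
  · intro P
    constructor
    · rintro ⟨Q, ⟨v, hv, hv2, hQ⟩, rfl⟩
      rw [mk_eq_iff] at hQ
      refine ⟨v 0, v 1, ?_⟩
      rw [act_submodule g hQ, vec_expand]
      simp [hv2]
    · rintro ⟨a, b, hP⟩
      have hne := pt_ne hP
      have hx := vec_expand (algebraMap K L) g ![a, b, 0]
      simp only [Matrix.cons_val_zero, Matrix.cons_val_one, Matrix.cons_val, map_zero, zero_smul,
        add_zero] at hx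
      rw [← hx] at hP hne
      have hne' : (fun i => algebraMap K L (![a, b, 0] i)) ≠ 0 := by
        intro h; rw [h] at hne; simp at hne
      refine ⟨_, ⟨_, hne', by simp, rfl⟩, ?_⟩
      exact pt_ext ((act_submodule g (Projectivization.submodule_mk _ _)).trans hP.symm)

lemma subplane_of_pts [Algebra K L] {u v t : Fin 3 → L} (h : Ind3 u v t) :
    IsOSubplane K L (pts (algebraMap K L) u v t) := by
  have hli2 : LinearIndependent L ![u, v, t] := by
    rw [Fintype.linearIndependent_iff]
    intro g hg
    simp only [Fin.sum_univ_three, Matrix.cons_val_zero, Matrix.cons_val_one,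
      Matrix.cons_val] at hg
    have := h (g 0) (g 1) (g 2) hg
    intro i
    fin_cases i
    exacts [this.1, this.2.1, this.2.2]
  let b := basisOfLinearIndependentOfCardEqFinrank hli2 (by simp)
  let e := (Pi.basisFun L (Fin 3)).equiv b (Equiv.refl _)
  let g := LinearMap.GeneralLinearGroup.ofLinearEquiv e
  have hg : ∀ i, g.toLinearEquiv (Pi.single i 1) = ![u, v, t] i := by
    intro i
    have : e (Pi.basisFun L (Fin 3) i) = b i := (Pi.basisFun L (Fin 3)).equiv_apply i b (Equiv.refl _)
    rw [Pi.basisFun_apply] at this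
    change e (Pi.single i 1) = _
    rw [this]
    simp [b]
  refine ⟨g, ?_⟩
  rw [image_std, hg, hg, hg]
  simp

lemma subplane_pts [Algebra K L] {B : Set (ℙ L (Fin 3 → L))} (h : IsOSubplane K L B) :
    ∃ u v t : Fin 3 → L, Ind3 u v t ∧ B = pts (algebraMap K L) u v t := by
  obtain ⟨g, rfl⟩ := h
  refine ⟨_, _, _, ?_, image_std g⟩
  intro a b c hab
  rw [← map_smul, ← map_smul, ← map_smul, ← map_add, ← map_add,
    map_eq_zero_iff _ g.toLinearEquiv.injective] at hab
  have h0 := congrFun hab 0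
  have h1 := congrFun hab 1
  have h2 := congrFun hab 2
  simp at h0 h1 h2
  exact ⟨h0, h1, h2⟩

lemma tangent_nf [Algebra K L] {B : Set (ℙ L (Fin 3 → L))} (h : IsOSubplane K L B)
    {T : ℙ L (Fin 3 → L)} (hT : B ∩ linfty L = {T}) :
    ∃ u v t : Fin 3 → L, Ind3 u v t ∧ t 2 = 0 ∧ T.submodule = Submodule.span L {t} ∧
      KInd (algebraMap K L) (u 2) (v 2) ∧ B = pts (algebraMap K L) u v t := by
  obtain ⟨u, v, w, hi, rfl⟩ := subplane_pts h
  have hTm : T ∈ pts (algebraMap K L) u v w ∩ linfty L := by rw [hT]; rfl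
  obtain ⟨⟨a, b, c, hTs⟩, hTl⟩ := hTm
  rw [mem_linfty hTs] at hTl
  set t := algebraMap K L a • u + algebraMap K L b • v + algebraMap K L c • w with ht
  have hne := pt_ne hTs
  suffices H : ∃ u' v', Ind3 u' v' t ∧ pts (algebraMap K L) u v w = pts (algebraMap K L) u' v' t by
    obtain ⟨u', v', h1, h2⟩ := H
    rw [h2] at hT ⊢
    exact ⟨u', v', t, h1, hTl, hTs, kind_of_tangent h1 hTs hT, rfl⟩
  have hmt : t ∈ Submodule.span K {u, v, w} := mem_spanK.2 ⟨a, b, c, rfl⟩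
  have hmu : u ∈ Submodule.span K {u, v, w} := Submodule.subset_span (by simp)
  have hmv : v ∈ Submodule.span K {u, v, w} := Submodule.subset_span (by simp)
  have hmw : w ∈ Submodule.span K {u, v, w} := Submodule.subset_span (by simp)
  by_cases ha : a = 0
  · by_cases hb : b = 0
    · have hc : c ≠ 0 := by
        rintro rfl
        apply hne; rw [ht, ha, hb]; simp
      refine ⟨u, v, pts_congr hi ?_ hmu hmv hmt⟩
      intro x y z e
      have := hi (algebraMap K L (x + z * a)) (algebraMap K L (y + z * b)) (algebraMap K L (z * c))
        (by simp only [map_add, map_mul]; rw [ht] at e; linear_combination (norm := module) e)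
      simp only [map_eq_zero] at this
      simpa [ha, hb, hc] using this
    · refine ⟨u, w, pts_congr hi ?_ hmu hmw hmt⟩
      intro x y z e
      have := hi (algebraMap K L (x + z * a)) (algebraMap K L (z * b)) (algebraMap K L (y + z * c))
        (by simp only [map_add, map_mul]; rw [ht] at e; linear_combination (norm := module) e)
      simp only [map_eq_zero] at this
      have hz : z = 0 := by simpa [hb] using this.2.1
      simpa [ha, hb, hz] using this
  · refine ⟨v, w, pts_congr hi ?_ hmv hmw hmt⟩
    intro x y z e
    have := hi (algebraMap K L (z * a)) (algebraMap K L (x + z * b)) (algebraMap K L (y + z * c))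
      (by simp only [map_add, map_mul]; rw [ht] at e; linear_combination (norm := module) e)
    simp only [map_eq_zero] at this
    have hz : z = 0 := by simpa [ha] using this.1
    simpa [hz] using this

/-- Cramer: solving a consistent 3 × 2 system over `K`. -/
lemma cramer (f : K →+* L) {a1 b1 a2 b2 a3 b3 : K} {r s : L} (hD : a1 * b2 - a2 * b1 ≠ 0)
    (h1 : r * f a1 + s * f a2 = f a3) (h2 : r * f b1 + s * f b2 = f b3) :
    (∃ x, r = f x) ∧ (∃ y, s = f y) := by
  have hD' : f (a1 * b2 - a2 * b1) ≠ 0 := by rw [Ne, map_eq_zero]; exact hD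
  refine ⟨⟨(a3 * b2 - a2 * b3) / (a1 * b2 - a2 * b1), ?_⟩,
    ⟨(a1 * b3 - a3 * b1) / (a1 * b2 - a2 * b1), ?_⟩⟩
  · rw [map_div₀, eq_div_iff hD']
    simp only [map_sub, map_mul]
    linear_combination f b2 * h1 - f a2 * h2
  · rw [map_div₀, eq_div_iff hD']
    simp only [map_sub, map_mul]
    linear_combination f a1 * h2 - f b1 * h1

lemma contain_nf [Algebra K L] {u v t w₁ w₂ : Fin 3 → L} (hi : Ind3 u v t) (ht : t 2 = 0)
    (hw : Ind2 w₁ w₂) (hk : KInd (algebraMap K L) (w₁ 2) (w₂ 2))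
    (hc : ∀ P : ℙ L (Fin 3 → L), (∃ a b : K,
      P.submodule = Submodule.span L {algebraMap K L a • w₁ + algebraMap K L b • w₂}) →
      P ∈ pts (algebraMap K L) u v t) :
    ∃ t', Ind3 w₁ w₂ t' ∧ t' 2 = 0 ∧
      pts (algebraMap K L) u v t = pts (algebraMap K L) w₁ w₂ t' := by
  have get : ∀ a b : K, (a ≠ 0 ∨ b ≠ 0) → ∃ z : L, z ≠ 0 ∧ ∃ x y c : K,
      z • (algebraMap K L a • w₁ + algebraMap K L b • w₂) =
        algebraMap K L x • u + algebraMap K L y • v + algebraMap K L c • t := by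
    intro a b hab
    have hne : algebraMap K L a • w₁ + algebraMap K L b • w₂ ≠ 0 := by
      intro e
      have := hw _ _ e
      simp only [map_eq_zero] at this
      tauto
    obtain ⟨P, hP⟩ := exists_pt _ hne
    obtain ⟨x, y, c, hP'⟩ := hc P ⟨a, b, hP⟩
    obtain ⟨z, hz, e⟩ := span_eq_iff.1 (hP.symm.trans hP')
    exact ⟨z, hz, x, y, c, e⟩
  obtain ⟨z1, hz1, a1, b1, c1, e1⟩ := get 1 0 (by simp)
  obtain ⟨z2, hz2, a2, b2, c2, e2⟩ := get 0 1 (by simp)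
  obtain ⟨z3, hz3, a3, b3, c3, e3⟩ := get 1 1 (by simp)
  set f := algebraMap K L with hf
  simp only [map_one, map_zero, one_smul, zero_smul, zero_add, add_zero] at e1 e2 e3
  obtain ⟨r, hr⟩ : ∃ r, r = z3 / z1 := ⟨_, rfl⟩
  obtain ⟨s, hs⟩ : ∃ s, s = z3 / z2 := ⟨_, rfl⟩
  have hr' : r * z1 = z3 := by rw [hr]; field_simp
  have hs' : s * z2 = z3 := by rw [hs]; field_simp
  have e1' : z3 • w₁ = r • (f a1 • u + f b1 • v + f c1 • t) := by
    rw [← e1, smul_smul, hr']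
  have e2' : z3 • w₂ = s • (f a2 • u + f b2 • v + f c2 • t) := by
    rw [← e2, smul_smul, hs']
  have E := hi (r * f a1 + s * f a2 - f a3) (r * f b1 + s * f b2 - f b3)
    (r * f c1 + s * f c2 - f c3) (by
      linear_combination (norm := module) e3 - e1' - e2')
  obtain ⟨Ea, Eb, Ec⟩ := E
  rw [sub_eq_zero] at Ea Eb Ec
  have hrs : (∃ x, r = f x) ∧ (∃ y, s = f y) := by
    by_cases h1 : a1 * b2 - a2 * b1 = 0
    · by_cases h2 : a1 * c2 - a2 * c1 = 0
      · by_cases h3 : b1 * c2 - b2 * c1 = 0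
        · exfalso
          have h1' := congrArg f h1
          have h2' := congrArg f h2
          have h3' := congrArg f h3
          simp only [map_sub, map_mul, map_zero] at h1' h2' h3'
          have ka := hw (f a2 * z1) (-(f a1 * z2)) (by
            have : f a2 • (z1 • w₁) - f a1 • (z2 • w₂) =
              (f a2 * f b1 - f a1 * f b2) • v + (f a2 * f c1 - f a1 * f c2) • t := by
              rw [e1, e2]; module
            rw [show f a2 * f b1 - f a1 * f b2 = 0 by linear_combination -h1',
              show f a2 * f c1 - f a1 * f c2 = 0 by linear_combination -h2'] at this
            linear_combination (norm := module) this)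
          have kb := hw (f b2 * z1) (-(f b1 * z2)) (by
            have : f b2 • (z1 • w₁) - f b1 • (z2 • w₂) =
              (f b2 * f a1 - f b1 * f a2) • u + (f b2 * f c1 - f b1 * f c2) • t := by
              rw [e1, e2]; module
            rw [show f b2 * f a1 - f b1 * f a2 = 0 by linear_combination h1',
              show f b2 * f c1 - f b1 * f c2 = 0 by linear_combination -h3'] at this
            linear_combination (norm := module) this)
          have kc := hw (f c2 * z1) (-(f c1 * z2)) (by
            have : f c2 • (z1 • w₁) - f c1 • (z2 • w₂) =
              (f c2 * f a1 - f c1 * f a2) • u + (f c2 * f b1 - f c1 * f b2) • v := by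
              rw [e1, e2]; module
            rw [show f c2 * f a1 - f c1 * f a2 = 0 by linear_combination h2',
              show f c2 * f b1 - f c1 * f b2 = 0 by linear_combination h3'] at this
            linear_combination (norm := module) this)
          simp only [neg_eq_zero, mul_eq_zero, hz1, hz2, or_false] at ka kb kc
          rw [ka.2, kb.2, kc.2] at e1
          have := hw z1 0 (by rw [e1]; simp)
          exact hz1 this.1
        · exact cramer f h3 Eb Ec
      · exact cramer f h2 Ea Ec
    · exact cramer f h1 Ea Eb
  obtain ⟨⟨x, hx⟩, ⟨y, hy⟩⟩ := hrs
  have key := pts_congr (K := K) (u' := z3 • w₁) (v' := z3 • w₂) (t' := t) hi (by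
      intro a b c e
      have e' := congrFun e 2
      simp only [Pi.add_apply, Pi.smul_apply, smul_eq_mul, ht, mul_zero, add_zero,
        Pi.zero_apply] at e'
      obtain ⟨ha, hb⟩ := hk a b (by
        apply zero_of_mul hz3
        linear_combination e')
      refine ⟨ha, hb, ?_⟩
      simpa [ha, hb, ind3_ne hi] using e)
    (mem_spanK.2 ⟨x * a1, x * b1, x * c1, by
      rw [e1', hx]; simp only [map_mul]; module⟩)
    (mem_spanK.2 ⟨y * a2, y * b2, y * c2, by
      rw [e2', hy]; simp only [map_mul]; module⟩)
    (Submodule.subset_span (by simp))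
  refine ⟨z3⁻¹ • t, ?_, by simp [ht], ?_⟩
  · intro a b c e
    have := key.1 a b c (by
      have h3 : z3 • (a • w₁ + b • w₂ + c • z3⁻¹ • t) = a • z3 • w₁ + b • z3 • w₂ + c • t := by
        rw [smul_add, smul_add, smul_comm z3 c, smul_inv_smul₀ hz3]; module
      rw [← h3, e, smul_zero])
    exact this
  · rw [key.2, ← pts_scale (t := z3⁻¹ • t) hz3, smul_inv_smul₀ hz3]

lemma unique_aux [Algebra K L] (hdim : Module.finrank K L = 3) {w₁ w₂ t t' : Fin 3 → L}
    (hk : KInd (algebraMap K L) (w₁ 2) (w₂ 2)) (hi : Ind3 w₁ w₂ t) (hi' : Ind3 w₁ w₂ t')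
    (ht : t 2 = 0) (ht' : t' 2 = 0)
    (H : splashOf L (pts (algebraMap K L) w₁ w₂ t) = splashOf L (pts (algebraMap K L) w₁ w₂ t')) :
    pts (algebraMap K L) w₁ w₂ t = pts (algebraMap K L) w₁ w₂ t' := by
  rw [splash_pts hi ht hk, splash_pts hi' ht' hk] at H
  have hd := ind3_ind2 hi (α := w₁ 2) hk.ne_right
  have hd' := ind3_ind2 hi' (α := w₁ 2) hk.ne_right
  set d := w₂ 2 • w₁ - w₁ 2 • w₂
  obtain ⟨m, hm, rfl⟩ := span_eq_iff.1 (centre_unique hdim hk hd hd' H)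
  obtain ⟨k, rfl⟩ := mul_stable hdim hk m (by
    intro c hc
    obtain ⟨P, hP⟩ := exists_pt _ (add_smul_ne hd' c)
    have hPm : P ∈ spl d t (VS (algebraMap K L) (w₁ 2) (w₂ 2)) := H ▸ Or.inr ⟨c, hc, hP⟩
    rcases hPm with h | ⟨e, he, h⟩
    · exfalso
      obtain ⟨z, hz, h⟩ := span_eq_iff.1 (hP.symm.trans h)
      have := ind2_eq hd (a := z) (b := z * c * m) (a' := 0) (b' := 1)
        (by linear_combination (norm := module) h)
      exact hz this.1
    · obtain ⟨z, hz, h⟩ := span_eq_iff.1 (hP.symm.trans h)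
      have := ind2_eq hd (a := z) (b := z * c * m) (a' := 1) (b' := e)
        (by linear_combination (norm := module) h)
      rw [this.1] at this
      rw [show m * c = e by linear_combination this.2]
      exact he)
  exact (pts_congr hi (by
      intro a b c e
      have := hi' _ _ _ e
      simpa only [map_eq_zero] using this)
    (Submodule.subset_span (by simp)) (Submodule.subset_span (by simp))
    (mem_spanK.2 ⟨0, 0, k, by simp⟩)).2

lemma exists_aux [Algebra K L] (hdim : Module.finrank K L = 3) {u v t w₁ w₂ : Fin 3 → L}
    (hi : Ind3 u v t) (ht : t 2 = 0) (hku : KInd (algebraMap K L) (u 2) (v 2))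
    (hk : KInd (algebraMap K L) (w₁ 2) (w₂ 2)) {c₀ l : L}
    (hc₀ : c₀ ∈ VS (algebraMap K L) (u 2) (v 2)) (hl : l ≠ 0)
    (hd : w₂ 2 • w₁ - w₁ 2 • w₂ = l • (v 2 • u - u 2 • v + c₀ • t)) :
    ∃ t', Ind3 w₁ w₂ t' ∧ t' 2 = 0 ∧
      splashOf L (pts (algebraMap K L) w₁ w₂ t') = splashOf L (pts (algebraMap K L) u v t) := by
  have hkl : KInd (algebraMap K L) (l * u 2) (l * v 2) := by
    intro x y e
    exact hku x y (zero_of_mul hl (by linear_combination e))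
  have hVl : ∀ c, c ∈ VS (algebraMap K L) (u 2) (v 2) ↔
      l * c ∈ VS (algebraMap K L) (l * u 2) (l * v 2) := by
    intro c
    constructor
    · rintro ⟨x, y, rfl⟩; exact ⟨x, y, by ring⟩
    · rintro ⟨x, y, e⟩
      exact ⟨x, y, mul_left_cancel₀ hl (by linear_combination e)⟩
  obtain ⟨s, hs, hV⟩ := exists_scale' hdim hk hkl
  have hpt := ind3_ind2 hi (α := u 2) hku.ne_right
  have hi' : Ind3 w₁ w₂ (s • t) := by
    intro x y z e
    have e2 := congrFun e 2
    simp only [Pi.add_apply, Pi.smul_apply, smul_eq_mul, ht, mul_zero, add_zero,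
        Pi.zero_apply] at e2
    have hβ := hk.ne_right
    obtain ⟨n, hn⟩ : ∃ n, n = x / w₂ 2 := ⟨_, rfl⟩
    have hx : x = n * w₂ 2 := by rw [hn]; field_simp
    have hy : y = - (n * w₁ 2) := by
      apply mul_right_cancel₀ hβ
      linear_combination e2 - w₁ 2 * hx
    have := hpt (n * l) (n * l * c₀ + z * s) (by
      rw [hx, hy] at e
      linear_combination (norm := module) e - n • hd)
    have hn0 : n = 0 := by simpa [hl] using this.1
    refine ⟨by rw [hx, hn0, zero_mul], by rw [hy, hn0]; simp, ?_⟩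
    simpa [hn0, hs] using this.2
  refine ⟨s • t, hi', by simp [ht], ?_⟩
  rw [splash_pts hi ht hku, splash_pts hi' (by simp [ht]) hk, hd]
  have hst : Submodule.span L {s • t} = Submodule.span L {t} :=
    (span_eq_iff.2 ⟨s, hs, rfl⟩).symm
  set p := v 2 • u - u 2 • v
  have key : ∀ c e : L, s * c = l * e →
      Submodule.span L {l • (p + c₀ • t) + c • s • t} = Submodule.span L {p + (c₀ + e) • t} := by
    intro c e h
    refine (span_eq_iff.2 ⟨l, hl, ?_⟩).symm
    have : c • s • t = (l * e) • t := by rw [smul_smul, mul_comm c s, h]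
    rw [this]
    module
  ext P
  simp only [spl, hst]
  constructor
  · rintro (h | ⟨c, hc, h⟩)
    · exact Or.inl h
    · refine Or.inr ⟨c₀ + s * c / l, VS_add hc₀ ?_, ?_⟩
      · rw [hVl, mul_div_cancel₀ _ hl, ← hV]; exact hc
      · rw [h]; exact key _ _ (mul_div_cancel₀ _ hl).symm
  · rintro (h | ⟨c, hc, h⟩)
    · exact Or.inl h
    · have e : s * (l * (c - c₀) / s) = l * (c - c₀) := mul_div_cancel₀ _ hs
      refine Or.inr ⟨l * (c - c₀) / s, ?_, ?_⟩
      · rw [hV, e, ← hVl]; exact VS_sub hc hc₀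
      · rw [h, key _ _ e]; congr 4; ring

end
end TSplash

open TSplash

/-- let S_T be the tangent splash, with centre T, of some order-q-subplane of
PG(2,q³) tangent to ℓ∞, and let ℓ be an order-q-subline disjoint from ℓ∞ such that the unique
line of PG(2,q³) containing ℓ meets ℓ∞ in a point of S_T ∖ {T}. Then there is exactly one
order-q-subplane of PG(2,q³) tangent to ℓ∞ which contains ℓ and has tangent splash S_T. -/
theorem tangent_splash_stmt_0
    (q : ℕ) (K L : Type) [Field K] [Field L] [Algebra K L] [Fintype K]
    (hK : Fintype.card K = q) (hdim : Module.finrank K L = 3)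
    -- B₀ is an order-q-subplane tangent to ℓ∞ at T, with tangent splash S_T
    (B₀ : Set (ℙ L (Fin 3 → L))) (T : ℙ L (Fin 3 → L))
    (hB₀ : IsOSubplane K L B₀) (htan : B₀ ∩ linfty L = {T})
    (ST : Set (ℙ L (Fin 3 → L))) (hST : ST = splashOf L B₀)
    -- ℓ is an order-q-subline disjoint from ℓ∞
    (ℓ : Set (ℙ L (Fin 3 → L))) (hℓ : IsOSubline K L ℓ) (hdisj : ℓ ∩ linfty L = ∅)
    -- the (unique) line of PG(2,q³) containing ℓ meets ℓ∞ in a point M of S_T ∖ {T}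
    (W : Submodule L (Fin 3 → L)) (hW : Module.finrank L W = 2)
    (hℓW : ∀ P ∈ ℓ, P.submodule ≤ W)
    (M : ℙ L (Fin 3 → L)) (hMW : M.submodule ≤ W) (hMinf : M ∈ linfty L)
    (hMS : M ∈ ST) (hMT : M ≠ T) :
    ∃! B' : Set (ℙ L (Fin 3 → L)),
      IsOSubplane K L B' ∧ (∃ T' : ℙ L (Fin 3 → L), B' ∩ linfty L = {T'}) ∧
        ℓ ⊆ B' ∧ splashOf L B' = ST := by

  obtain ⟨u, v, t, hi, ht, hTs, hku, rfl⟩ := tangent_nf hB₀ htan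
  obtain ⟨w₁, w₂, hw, hmem⟩ := subline_nf hℓ
  have hne : ∀ a b : K, (a ≠ 0 ∨ b ≠ 0) →
      algebraMap K L a • w₁ + algebraMap K L b • w₂ ≠ 0 := by
    intro a b hab e
    have := hw _ _ e
    simp only [map_eq_zero] at this
    tauto
  have hk : KInd (algebraMap K L) (w₁ 2) (w₂ 2) := by
    intro a b hab
    by_contra hcon
    obtain ⟨P, hP⟩ := exists_pt _ (hne a b (by tauto))
    have : P ∈ ℓ ∩ linfty L := ⟨(hmem P).2 ⟨a, b, hP⟩, (mem_linfty hP).2 hab⟩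
    rw [hdisj] at this
    exact this
  have hin : ∀ a b : K, (a ≠ 0 ∨ b ≠ 0) →
      algebraMap K L a • w₁ + algebraMap K L b • w₂ ∈ W := by
    intro a b hab
    obtain ⟨P, hP⟩ := exists_pt _ (hne a b hab)
    have := hℓW P ((hmem P).2 ⟨a, b, hP⟩)
    rw [hP, Submodule.span_singleton_le_iff_mem] at this
    exact this
  have hw₁ : w₁ ∈ W := by simpa using hin 1 0 (by simp)
  have hw₂ : w₂ ∈ W := by simpa using hin 0 1 (by simp)
  have hWs : Submodule.span L {w₁, w₂} = W := by
    have hli : LinearIndependent L ![w₁, w₂] := by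
      rw [LinearIndependent.pair_iff]
      exact hw
    have hf := finrank_span_eq_card hli
    rw [show Set.range ![w₁, w₂] = {w₁, w₂} by simp [Matrix.range_cons, Set.pair_comm]] at hf
    refine Submodule.eq_of_le_of_finrank_eq ?_ ?_
    · rw [Submodule.span_le]
      rintro x (rfl | rfl)
      exacts [hw₁, hw₂]
    · rw [hf, hW]; simp
  -- the point M
  rw [hST, splash_pts hi ht hku] at hMS
  rcases hMS with hM | ⟨c₀, hc₀, hM⟩
  · exact absurd (pt_ext (hM.trans hTs.symm)) hMT
  have hMd : M.submodule = Submodule.span L {w₂ 2 • w₁ - w₁ 2 • w₂} := by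
    obtain ⟨m, hm0, hm⟩ := pt_rep M
    rw [hm, Submodule.span_singleton_le_iff_mem, ← hWs, Submodule.mem_span_pair] at hMW
    obtain ⟨x, y, rfl⟩ := hMW
    rw [mem_linfty hm] at hMinf
    simp only [Pi.add_apply, Pi.smul_apply, smul_eq_mul] at hMinf
    have hβ := hk.ne_right
    obtain ⟨n, hn⟩ : ∃ n, n = x / w₂ 2 := ⟨_, rfl⟩
    have hx : x = n * w₂ 2 := by rw [hn]; field_simp
    have hy : y = - (n * w₁ 2) := by
      apply mul_right_cancel₀ hβ
      linear_combination hMinf - w₁ 2 * hx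
    have e : x • w₁ + y • w₂ = n • (w₂ 2 • w₁ - w₁ 2 • w₂) := by rw [hx, hy]; module
    rw [e] at hm hm0
    rw [hm]
    exact (span_eq_iff.2 ⟨n, fun h => hm0 (by rw [h, zero_smul]), rfl⟩).symm
  obtain ⟨l, hl, hd⟩ := span_eq_iff.1 (hM.symm.trans hMd)
  obtain ⟨t', hi', ht', hspl⟩ := exists_aux hdim hi ht hku hk hc₀ hl hd.symm
  refine ⟨pts (algebraMap K L) w₁ w₂ t', ⟨subplane_of_pts hi', ?_, ?_, hspl.trans hST.symm⟩, ?_⟩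
  · obtain ⟨P, hP⟩ := exists_pt _ (ind3_ne hi')
    exact ⟨P, pts_tangent hi' ht' hk hP⟩
  · intro P hP
    obtain ⟨a, b, hP⟩ := (hmem P).1 hP
    exact ⟨a, b, 0, by simpa using hP⟩
  · rintro B' ⟨hB', ⟨T', hT'⟩, hsub, hS⟩
    obtain ⟨u', v', s, hj, hs, -, -, rfl⟩ := tangent_nf hB' hT'
    obtain ⟨s', hj', hs', heq⟩ := contain_nf hj hs hw hk (fun P hP => hsub ((hmem P).2 hP))
    rw [heq] at hS ⊢
    exact unique_aux hdim hk hj' hi' hs' ht' (hS.trans (hST.trans hspl.symm))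

end
end

section
/- The subgroup of PGL(3,L) consisting of the elements that fix ℓ∞ setwise acts transitively on the set of all order-q-subplanes of PG(2,q³) tangent to ℓ∞, and acts transitively on the set of all tangent splashes of ℓ∞ (i.e., the sets arising as the tangent splash of some order-q-subplane tangent to ℓ∞). -/
open scoped LinearAlgebra.Projectivization
open Module

noncomputable section

lemma ts_act_mk {L : Type*} [Field L] (g : LinearMap.GeneralLinearGroup L (Fin 3 → L))
    (v : Fin 3 → L) (h : v ≠ 0) (h' : g.1 v ≠ 0) :
    actGL3 L g (Projectivization.mk L v h) = Projectivization.mk L (g.1 v) h' := rfl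

lemma ts_ne {L : Type*} [Field L] (g : LinearMap.GeneralLinearGroup L (Fin 3 → L))
    {v : Fin 3 → L} (h : v ≠ 0) : g.1 v ≠ 0 := by
  intro h0
  exact h (g.toLinearEquiv.injective (by rw [map_zero]; exact h0))

lemma ts_act_mul {L : Type*} [Field L] (a b : LinearMap.GeneralLinearGroup L (Fin 3 → L))
    (P : ℙ L (Fin 3 → L)) : actGL3 L (a * b) P = actGL3 L a (actGL3 L b P) := by
  induction P using Projectivization.ind with
  | h v hv => rfl

lemma ts_act_one {L : Type*} [Field L] (P : ℙ L (Fin 3 → L)) : actGL3 L 1 P = P := by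
  induction P using Projectivization.ind with
  | h v hv => rfl

lemma ts_act_inv {L : Type*} [Field L] (g : LinearMap.GeneralLinearGroup L (Fin 3 → L))
    (P : ℙ L (Fin 3 → L)) : actGL3 L g⁻¹ (actGL3 L g P) = P := by
  rw [← ts_act_mul, inv_mul_cancel, ts_act_one]

lemma ts_act_inv' {L : Type*} [Field L] (g : LinearMap.GeneralLinearGroup L (Fin 3 → L))
    (P : ℙ L (Fin 3 → L)) : actGL3 L g (actGL3 L g⁻¹ P) = P := by
  rw [← ts_act_mul, mul_inv_cancel, ts_act_one]

lemma ts_mem_linfty {L : Type*} [Field L] (v : Fin 3 → L) (h : v ≠ 0) :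
    Projectivization.mk L v h ∈ linfty L ↔ v 2 = 0 := by
  obtain ⟨a, ha⟩ := Projectivization.exists_smul_eq_mk_rep L v h
  change (Projectivization.mk L v h).rep 2 = 0 ↔ _
  rw [← ha]
  simp [Units.smul_def]

lemma ts_act_submodule {L : Type*} [Field L] (g : LinearMap.GeneralLinearGroup L (Fin 3 → L))
    (P : ℙ L (Fin 3 → L)) : (actGL3 L g P).submodule = P.submodule.map g.1 := by
  induction P using Projectivization.ind with
  | h v hv =>
    rw [ts_act_mk g v hv (ts_ne g hv), Projectivization.submodule_mk,
      Projectivization.submodule_mk, Submodule.map_span, Set.image_singleton]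

/-- Image of a splash is contained in the splash of the image. -/
lemma ts_splash_sub {L : Type*} [Field L] (g : LinearMap.GeneralLinearGroup L (Fin 3 → L))
    (hg : actGL3 L g '' linfty L = linfty L) (B : Set (ℙ L (Fin 3 → L))) :
    actGL3 L g '' splashOf L B ⊆ splashOf L (actGL3 L g '' B) := by
  rintro _ ⟨P, ⟨hP, A₁, h1, A₂, h2, hne, hle⟩, rfl⟩
  refine ⟨hg ▸ ⟨P, hP, rfl⟩, _, ⟨A₁, h1, rfl⟩, _, ⟨A₂, h2, rfl⟩, ?_, ?_⟩
  · intro h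
    apply hne
    rw [← ts_act_inv g A₁, h, ts_act_inv]
  · rw [ts_act_submodule, ts_act_submodule, ts_act_submodule, ← Submodule.map_sup]
    exact Submodule.map_mono hle

lemma ts_image_inv {L : Type*} [Field L] (g : LinearMap.GeneralLinearGroup L (Fin 3 → L))
    (S : Set (ℙ L (Fin 3 → L))) : actGL3 L g⁻¹ '' (actGL3 L g '' S) = S := by
  rw [Set.image_image]; simp [ts_act_inv]

lemma ts_image_inv' {L : Type*} [Field L] (g : LinearMap.GeneralLinearGroup L (Fin 3 → L))
    (S : Set (ℙ L (Fin 3 → L))) : actGL3 L g '' (actGL3 L g⁻¹ '' S) = S := by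
  rw [Set.image_image]; simp [ts_act_inv']

lemma ts_splash {L : Type*} [Field L] (g : LinearMap.GeneralLinearGroup L (Fin 3 → L))
    (hg : actGL3 L g '' linfty L = linfty L) (B : Set (ℙ L (Fin 3 → L))) :
    actGL3 L g '' splashOf L B = splashOf L (actGL3 L g '' B) := by
  apply (ts_splash_sub g hg B).antisymm
  have hg' : actGL3 L g⁻¹ '' linfty L = linfty L := by
    conv_lhs => rw [← hg]
    exact ts_image_inv g _
  have h := Set.image_mono (f := actGL3 L g) (ts_splash_sub g⁻¹ hg' (actGL3 L g '' B))
  rwa [ts_image_inv', ts_image_inv] at h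

/-- The inclusion of K³ in L³. -/
def tsIota (K L : Type*) [Field K] [Field L] [Algebra K L] :
    (Fin 3 → K) →ₗ[K] (Fin 3 → L) := (Algebra.linearMap K L).compLeft (Fin 3)

lemma tsIota_def {K L : Type*} [Field K] [Field L] [Algebra K L] (v : Fin 3 → K) :
    tsIota K L v = fun i => algebraMap K L (v i) := rfl

lemma tsIota_inj {K L : Type*} [Field K] [Field L] [Algebra K L] :
    Function.Injective (tsIota K L) := by
  intro v w h
  funext i
  exact (algebraMap K L).injective (congrFun h i)

/-- The third coordinate after applying g, on K³. -/
def tsPhi (K : Type*) {L : Type*} [Field K] [Field L] [Algebra K L]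
    (g : LinearMap.GeneralLinearGroup L (Fin 3 → L)) : (Fin 3 → K) →ₗ[K] L :=
  ((LinearMap.proj 2 ∘ₗ g.1 : (Fin 3 → L) →ₗ[L] L).restrictScalars K) ∘ₗ tsIota K L

lemma tsPhi_apply {K L : Type*} [Field K] [Field L] [Algebra K L]
    (g : LinearMap.GeneralLinearGroup L (Fin 3 → L)) (v : Fin 3 → K) :
    tsPhi K g v = g.1 (tsIota K L v) 2 := rfl

lemma ts_ker {K L : Type*} [Field K] [Field L] [Algebra K L]
    (g : LinearMap.GeneralLinearGroup L (Fin 3 → L))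
    (h : ∃ T, (actGL3 L g '' stdSubplane K L) ∩ linfty L = {T}) :
    finrank K (LinearMap.ker (tsPhi K g)) = 1 := by
  obtain ⟨T, hT⟩ := h
  have hT0 : T ∈ (actGL3 L g '' stdSubplane K L) ∩ linfty L := by rw [hT]; rfl
  obtain ⟨⟨_, ⟨v₀, h₀, rfl⟩, hgT⟩, hinf⟩ := hT0
  rw [ts_act_mk g _ h₀ (ts_ne g h₀)] at hgT
  have hv0 : v₀ ≠ 0 := by
    rintro rfl
    exact h₀ (map_zero (tsIota K L))
  have hk0 : v₀ ∈ LinearMap.ker (tsPhi K g) := by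
    rw [LinearMap.mem_ker, tsPhi_apply]
    rw [← hgT, ts_mem_linfty] at hinf
    exact hinf
  rw [finrank_eq_one_iff']
  refine ⟨⟨v₀, hk0⟩, fun h => hv0 (congrArg Subtype.val h), ?_⟩
  rintro ⟨w, hw⟩
  by_cases hw0 : w = 0
  · exact ⟨0, by ext1; simp [hw0]⟩
  have hwL : tsIota K L w ≠ 0 := fun h => hw0 (tsIota_inj (h.trans (map_zero _).symm))
  have hwT : Projectivization.mk L (g.1 (tsIota K L w)) (ts_ne g hwL) ∈
      (actGL3 L g '' stdSubplane K L) ∩ linfty L :=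
    ⟨⟨_, ⟨w, hwL, rfl⟩, rfl⟩, (ts_mem_linfty _ _).2 hw⟩
  rw [hT, Set.mem_singleton_iff, ← hgT, Projectivization.mk_eq_mk_iff'] at hwT
  obtain ⟨a, ha⟩ := hwT
  have ha' : a • (fun i => algebraMap K L (v₀ i)) = tsIota K L w := by
    apply g.toLinearEquiv.injective
    rw [map_smul]
    exact ha
  obtain ⟨i, hi⟩ := Function.ne_iff.1 hv0
  have hi' : v₀ i ≠ 0 := hi
  have haK : a = algebraMap K L (w i / v₀ i) := by
    have := congrFun ha' i
    simp only [Pi.smul_apply, smul_eq_mul, tsIota_def] at this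
    rw [map_div₀, eq_div_iff (by simpa using hi'), this]
  refine ⟨w i / v₀ i, ?_⟩
  ext1
  apply tsIota_inj (L := L)
  rw [← ha', haK]
  funext j
  simp [tsIota_def, Algebra.smul_def]

/-- Two maps with the same range differ by an automorphism of the source. -/
lemma ts_equiv {K V W : Type*} [Field K] [AddCommGroup V] [Module K V] [FiniteDimensional K V]
    [AddCommGroup W] [Module K W] (f h : V →ₗ[K] W)
    (hr : LinearMap.range f = LinearMap.range h)
    (hk : finrank K (LinearMap.ker f) = finrank K (LinearMap.ker h)) :
    ∃ k : V ≃ₗ[K] V, ∀ x, h (k x) = f x := by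
  obtain ⟨s, hs⟩ := f.rangeRestrict.exists_rightInverse_of_surjective f.range_rangeRestrict
  obtain ⟨t, ht⟩ := h.rangeRestrict.exists_rightInverse_of_surjective h.range_rangeRestrict
  have hs' : ∀ y, f (s y) = y := fun y => congrArg Subtype.val (LinearMap.congr_fun hs y)
  have ht' : ∀ y, h (t y) = y := fun y => congrArg Subtype.val (LinearMap.congr_fun ht y)
  let e := LinearEquiv.ofFinrankEq _ _ hk
  let p : V →ₗ[K] LinearMap.ker f :=
    (LinearMap.id - s ∘ₗ f.rangeRestrict).codRestrict (LinearMap.ker f) (by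
      intro x
      simp [hs'])
  let r : V →ₗ[K] LinearMap.range h :=
    f.codRestrict (LinearMap.range h) (fun x => hr ▸ LinearMap.mem_range_self f x)
  let k : V →ₗ[K] V := t ∘ₗ r + (LinearMap.ker h).subtype ∘ₗ e.toLinearMap ∘ₗ p
  have hkx : ∀ x, h (k x) = f x := by
    intro x
    have h1 : h (e (p x) : V) = 0 := (e (p x)).2
    have h2 : k x = t (r x) + (e (p x) : V) := rfl
    rw [h2, map_add, h1, ht', add_zero]
    rfl
  have hinj : Function.Injective k := by
    rw [← LinearMap.ker_eq_bot, LinearMap.ker_eq_bot']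
    intro x hx
    have hf : f x = 0 := by rw [← hkx, hx, map_zero]
    have hrx : r x = 0 := Subtype.ext hf
    have hfx : f.rangeRestrict x = 0 := Subtype.ext hf
    have hpx : (p x : V) = x := by
      change x - s (f.rangeRestrict x) = x
      rw [hfx, map_zero, sub_zero]
    have h2 : k x = t (r x) + (e (p x) : V) := rfl
    rw [hx, hrx, map_zero, zero_add] at h2
    have h3 : p x = 0 := e.injective (by rw [map_zero]; exact Subtype.ext h2.symm)
    rw [← hpx, h3]; rfl
  exact ⟨LinearEquiv.ofInjectiveEndo k hinj, hkx⟩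

/-- A hyperplane is the kernel of a functional. -/
lemma ts_hyper {K L : Type*} [Field K] [Field L] [Algebra K L]
    (hdim : finrank K L = 3) (U : Submodule K L) (hU : finrank K U = 2) :
    ∃ f : L →ₗ[K] K, f ≠ 0 ∧ LinearMap.ker f = U := by
  have : FiniteDimensional K L := FiniteDimensional.of_finrank_pos (by omega)
  have hne : U ≠ ⊤ := by
    rintro rfl
    rw [finrank_top] at hU
    omega
  obtain ⟨f, hf, hle⟩ := Submodule.exists_le_ker_of_lt_top U hne.lt_top
  refine ⟨f, hf, (Submodule.eq_of_le_of_finrank_le hle ?_).symm⟩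
  have h1 := LinearMap.finrank_range_add_finrank_ker f
  have h2 : LinearMap.range f ≠ ⊥ := by simpa [LinearMap.range_eq_bot] using hf
  have h3 : 0 < finrank K (LinearMap.range f) :=
    Nat.pos_of_ne_zero (fun h => h2 (Submodule.finrank_eq_zero.1 h))
  omega

/-- Multiplications by scalars of L act transitively on K-hyperplanes of L. -/
lemma ts_scalar {K L : Type*} [Field K] [Field L] [Algebra K L]
    (hdim : finrank K L = 3) (U V : Submodule K L) (hU : finrank K U = 2)
    (hV : finrank K V = 2) : ∃ c : L, c ≠ 0 ∧ ∀ x, x ∈ U ↔ c * x ∈ V := by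
  have : FiniteDimensional K L := FiniteDimensional.of_finrank_pos (by omega)
  obtain ⟨f, hf, rfl⟩ := ts_hyper hdim U hU
  obtain ⟨h, hh, rfl⟩ := ts_hyper hdim V hV
  let m : L →ₗ[K] (L →ₗ[K] K) := (LinearMap.mul K L).compr₂ h
  have hm : ∀ c x, m c x = h (c * x) := fun c x => rfl
  have hinj : Function.Injective m := by
    rw [← LinearMap.ker_eq_bot, LinearMap.ker_eq_bot']
    intro c hc
    by_contra hc0
    apply hh
    ext x
    have := LinearMap.congr_fun hc (c⁻¹ * x)
    rwa [hm, mul_inv_cancel_left₀ hc0] at this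
  have hsurj : Function.Surjective m :=
    (LinearMap.injective_iff_surjective_of_finrank_eq_finrank
      (Subspace.dual_finrank_eq (K := K) (V := L)).symm).1 hinj
  obtain ⟨c, hc⟩ := hsurj f
  refine ⟨c, ?_, fun x => ?_⟩
  · rintro rfl
    exact hf (by rw [← hc, map_zero])
  · rw [LinearMap.mem_ker, LinearMap.mem_ker, ← hc, hm]

/-- Extension of scalars of an automorphism of K³. -/
lemma ts_ext {K L : Type*} [Field K] [Field L] [Algebra K L]
    (k : (Fin 3 → K) ≃ₗ[K] (Fin 3 → K)) :
    ∃ κ : LinearMap.GeneralLinearGroup L (Fin 3 → L),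
      ∀ v, κ.1 (tsIota K L v) = tsIota K L (k v) := by
  let M := LinearMap.toMatrix' k.toLinearMap
  let N := LinearMap.toMatrix' k.symm.toLinearMap
  have hMN : M * N = 1 := by
    rw [← LinearMap.toMatrix'_comp]; simp
  have hNM : N * M = 1 := by
    rw [← LinearMap.toMatrix'_comp]; simp
  refine ⟨⟨Matrix.toLin' (M.map (algebraMap K L)), Matrix.toLin' (N.map (algebraMap K L)),
    ?_, ?_⟩, ?_⟩
  · rw [Module.End.mul_eq_comp, ← Matrix.toLin'_mul, ← Matrix.map_mul, hMN]
    simp [Module.End.one_eq_id]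
  · rw [Module.End.mul_eq_comp, ← Matrix.toLin'_mul, ← Matrix.map_mul, hNM]
    simp [Module.End.one_eq_id]
  · intro v
    have hk : k v = M.mulVec v := (LinearMap.toMatrix'_mulVec k.toLinearMap v).symm
    funext i
    rw [hk, tsIota_def, tsIota_def]
    simp [Matrix.mulVec, dotProduct]

lemma ts_std_image {K L : Type*} [Field K] [Field L] [Algebra K L]
    (k : (Fin 3 → K) ≃ₗ[K] (Fin 3 → K)) (κ : LinearMap.GeneralLinearGroup L (Fin 3 → L))
    (h : ∀ v, κ.1 (tsIota K L v) = tsIota K L (k v)) :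
    actGL3 L κ '' stdSubplane K L = stdSubplane K L := by
  ext P
  constructor
  · rintro ⟨_, ⟨v, hv, rfl⟩, rfl⟩
    refine ⟨k v, ?_, ?_⟩
    · have := ts_ne κ hv
      rwa [← tsIota_def, h] at this
    · rw [ts_act_mk κ _ hv (ts_ne κ hv)]
      congr 1
      exact h v
  · rintro ⟨v, hv, rfl⟩
    have hk : κ.1 (tsIota K L (k.symm v)) = tsIota K L v := by
      rw [h, LinearEquiv.apply_symm_apply]
    have hne : tsIota K L (k.symm v) ≠ 0 := by
      intro h0
      rw [h0, map_zero] at hk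
      exact hv hk.symm
    refine ⟨Projectivization.mk L _ hne, ⟨k.symm v, hne, rfl⟩, ?_⟩
    rw [ts_act_mk κ _ hne (ts_ne κ hne)]
    congr 1

lemma ts_linfty_image {L : Type*} [Field L] (g : LinearMap.GeneralLinearGroup L (Fin 3 → L))
    (c : L) (hc : c ≠ 0) (h : ∀ v, g.1 v 2 = c * v 2) :
    actGL3 L g '' linfty L = linfty L := by
  have key : ∀ P, actGL3 L g P ∈ linfty L ↔ P ∈ linfty L := by
    intro P
    induction P using Projectivization.ind with
    | h v hv =>
      rw [ts_act_mk g v hv (ts_ne g hv), ts_mem_linfty, ts_mem_linfty, h]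
      simp [hc]
  ext P
  constructor
  · rintro ⟨Q, hQ, rfl⟩
    exact (key Q).2 hQ
  · intro hP
    refine ⟨actGL3 L g⁻¹ P, ?_, ts_act_inv' g P⟩
    rw [← key, ts_act_inv']
    exact hP

theorem ts_trans {K L : Type*} [Field K] [Field L] [Algebra K L] (hdim : finrank K L = 3)
    (B₁ B₂ : Set (ℙ L (Fin 3 → L))) (h₁ : IsOSubplane K L B₁) (h₂ : IsOSubplane K L B₂)
    (t₁ : ∃ T₁, B₁ ∩ linfty L = {T₁}) (t₂ : ∃ T₂, B₂ ∩ linfty L = {T₂}) :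
    ∃ g : LinearMap.GeneralLinearGroup L (Fin 3 → L),
      actGL3 L g '' linfty L = linfty L ∧ actGL3 L g '' B₁ = B₂ := by
  obtain ⟨g₁, rfl⟩ := h₁
  obtain ⟨g₂, rfl⟩ := h₂
  have k₁ := ts_ker g₁ t₁
  have k₂ := ts_ker g₂ t₂
  have r₁ : finrank K (LinearMap.range (tsPhi K g₁)) = 2 := by
    have := LinearMap.finrank_range_add_finrank_ker (tsPhi K g₁)
    rw [k₁, Module.finrank_fin_fun] at this
    omega
  have r₂ : finrank K (LinearMap.range (tsPhi K g₂)) = 2 := by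
    have := LinearMap.finrank_range_add_finrank_ker (tsPhi K g₂)
    rw [k₂, Module.finrank_fin_fun] at this
    omega
  obtain ⟨c, hc, hcx⟩ := ts_scalar hdim _ _ r₁ r₂
  let f : (Fin 3 → K) →ₗ[K] L := LinearMap.mul K L c ∘ₗ tsPhi K g₁
  have hf : ∀ x, f x = c * tsPhi K g₁ x := fun x => rfl
  have hker : LinearMap.ker f = LinearMap.ker (tsPhi K g₁) := by
    ext x
    rw [LinearMap.mem_ker, LinearMap.mem_ker, hf]
    simp [hc]
  have hrange : LinearMap.range f = LinearMap.range (tsPhi K g₂) := by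
    ext y
    constructor
    · rintro ⟨x, rfl⟩
      rw [hf, ← hcx]
      exact ⟨x, rfl⟩
    · intro hy
      have : c⁻¹ * y ∈ LinearMap.range (tsPhi K g₁) := by
        rw [hcx, mul_inv_cancel_left₀ hc]
        exact hy
      obtain ⟨x, hx⟩ := this
      exact ⟨x, by rw [hf, hx, mul_inv_cancel_left₀ hc]⟩
  obtain ⟨k, hk⟩ := ts_equiv f (tsPhi K g₂) hrange (by rw [hker, k₁, k₂])
  obtain ⟨κ, hκ⟩ := ts_ext (L := L) k
  have hfun : (LinearMap.proj 2 ∘ₗ g₂.1 ∘ₗ κ.1 : (Fin 3 → L) →ₗ[L] L) =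
      c • (LinearMap.proj 2 ∘ₗ g₁.1) := by
    refine (Pi.basisFun L (Fin 3)).ext fun i => ?_
    have hi : Pi.basisFun L (Fin 3) i = tsIota K L (Pi.single i 1) := by
      funext j
      rw [tsIota_def]
      by_cases hj : j = i
      · subst hj; simp
      · simp [hj]
    rw [hi]
    change g₂.1 (κ.1 (tsIota K L (Pi.single i 1))) 2 = c * tsPhi K g₁ (Pi.single i 1)
    rw [hκ, ← hf, ← hk]
    rfl
  refine ⟨g₂ * κ * g₁⁻¹, ts_linfty_image _ c hc fun v => ?_, ?_⟩
  · have h1 := LinearMap.congr_fun hfun ((g₁⁻¹).1 v)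
    have h2 : g₁.1 ((g₁⁻¹).1 v) = v := by
      change (g₁ * g₁⁻¹).1 v = v
      rw [mul_inv_cancel]; rfl
    change g₂.1 (κ.1 ((g₁⁻¹).1 v)) 2 = c * g₁.1 ((g₁⁻¹).1 v) 2 at h1
    rw [h2] at h1
    exact h1
  · have : actGL3 L (g₂ * κ * g₁⁻¹) '' (actGL3 L g₁ '' stdSubplane K L) =
        actGL3 L g₂ '' (actGL3 L κ '' stdSubplane K L) := by
      rw [Set.image_image, Set.image_image]
      simp only [ts_act_mul, ts_act_inv]
    rw [this, ts_std_image k κ hκ]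

/-- the subgroup of PGL(3,L) fixing ℓ∞ setwise is transitive on the
order-q-subplanes of PG(2,q³) tangent to ℓ∞, and transitive on the tangent splashes of ℓ∞. -/
theorem tangent_splash_stmt_1
    (q : ℕ) (K L : Type) [Field K] [Field L] [Algebra K L] [Fintype K]
    (hK : Fintype.card K = q) (hdim : Module.finrank K L = 3) :
    -- transitivity on order-q-subplanes tangent to ℓ∞
    (∀ B₁ B₂ : Set (ℙ L (Fin 3 → L)),
      IsOSubplane K L B₁ → IsOSubplane K L B₂ →
      (∃ T₁, B₁ ∩ linfty L = {T₁}) → (∃ T₂, B₂ ∩ linfty L = {T₂}) →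
      ∃ g : LinearMap.GeneralLinearGroup L (Fin 3 → L),
        actGL3 L g '' linfty L = linfty L ∧ actGL3 L g '' B₁ = B₂) ∧
    -- transitivity on tangent splashes of ℓ∞
    (∀ S₁ S₂ : Set (ℙ L (Fin 3 → L)),
      (∃ B₁ : Set (ℙ L (Fin 3 → L)), IsOSubplane K L B₁ ∧ (∃ T₁, B₁ ∩ linfty L = {T₁}) ∧
        S₁ = splashOf L B₁) →
      (∃ B₂ : Set (ℙ L (Fin 3 → L)), IsOSubplane K L B₂ ∧ (∃ T₂, B₂ ∩ linfty L = {T₂}) ∧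
        S₂ = splashOf L B₂) →
      ∃ g : LinearMap.GeneralLinearGroup L (Fin 3 → L),
        actGL3 L g '' linfty L = linfty L ∧ actGL3 L g '' S₁ = S₂) := by
  refine ⟨fun B₁ B₂ h₁ h₂ t₁ t₂ => ts_trans hdim B₁ B₂ h₁ h₂ t₁ t₂, ?_⟩
  rintro S₁ S₂ ⟨B₁, h₁, t₁, rfl⟩ ⟨B₂, h₂, t₂, rfl⟩
  obtain ⟨g, hg, rfl⟩ := ts_trans hdim B₁ B₂ h₁ h₂ t₁ t₂
  exact ⟨g, hg, ts_splash g hg B₁⟩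

end
end

section
/- Let E be the stabilizer in PGL(2,L) of the point [(1,0)] of ℙ(L²). Then |E| = q³(q³−1); E acts transitively on the q³ points of ℙ(L²) distinct from [(1,0)]; and E acts simply transitively on the set of order-q-sublines of ℙ(L²) that do not contain [(1,0)]. In particular, there are exactly q³(q³−1) order-q-sublines of ℙ(L²) not containing [(1,0)]. -/
open scoped LinearAlgebra.Projectivization
open Module

noncomputable section

/-- The action of an invertible L-linear map on the points of PG(1,q³) = ℙ L (Fin 2 → L).
Elements of PGL(2,L) are exactly the maps of this form. -/
def actGL2 (L : Type*) [Field L] (g : LinearMap.GeneralLinearGroup L (Fin 2 → L))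
    (P : ℙ L (Fin 2 → L)) : ℙ L (Fin 2 → L) :=
  Projectivization.map g.toLinearEquiv.toLinearMap g.toLinearEquiv.injective P

/-- The standard subline {[(x,y)] : (x,y) ∈ K² ∖ {0}} of ℙ(L²). -/
def stdSubline2 (K L : Type*) [Field K] [Field L] [Algebra K L] : Set (ℙ L (Fin 2 → L)) :=
  {P | ∃ (v : Fin 2 → K) (h : (fun i => algebraMap K L (v i)) ≠ 0),
    P = Projectivization.mk L (fun i => algebraMap K L (v i)) h}

/-- An order-q-subline of ℙ(L²): the image of the standard subline under an element of
PGL(2,L). -/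
def IsOSubline2 (K L : Type*) [Field K] [Field L] [Algebra K L]
    (S : Set (ℙ L (Fin 2 → L))) : Prop :=
  ∃ g : LinearMap.GeneralLinearGroup L (Fin 2 → L), S = actGL2 L g '' stdSubline2 K L

/-- The point [(1,0)] of ℙ(L²). -/
def ptInf (L : Type*) [Field L] : ℙ L (Fin 2 → L) :=
  Projectivization.mk L ![1, 0] (by intro hcon; simpa using congrFun hcon 0)

section helpers

variable {K L : Type} [Field K] [Field L] [Algebra K L]

local notation "GG" => LinearMap.GeneralLinearGroup L (Fin 2 → L)

lemma ts_apply_ne (g : GG) {v : Fin 2 → L} (hv : v ≠ 0) : g.1 v ≠ 0 := by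
  intro h
  exact hv (g.toLinearEquiv.injective (by
    change g.1 v = g.1 0
    rw [h, map_zero]))

lemma ts_act_mk_s2 (g : GG) (v : Fin 2 → L) (hv : v ≠ 0) :
    actGL2 L g (Projectivization.mk L v hv) =
      Projectivization.mk L (g.1 v) (ts_apply_ne g hv) := rfl

lemma ts_act_mul_s2 (g h : GG) (P : ℙ L (Fin 2 → L)) :
    actGL2 L (g * h) P = actGL2 L g (actGL2 L h P) := by
  induction P using Projectivization.ind with
  | h v hv => rfl

lemma ts_act_one_s2 (P : ℙ L (Fin 2 → L)) : actGL2 L (1 : GG) P = P := by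
  induction P using Projectivization.ind with
  | h v hv => rfl

lemma ts_act_inv_act (g : GG) (P : ℙ L (Fin 2 → L)) :
    actGL2 L g⁻¹ (actGL2 L g P) = P := by
  rw [← ts_act_mul_s2, inv_mul_cancel, ts_act_one_s2]

lemma ts_act_act_inv (g : GG) (P : ℙ L (Fin 2 → L)) :
    actGL2 L g (actGL2 L g⁻¹ P) = P := by
  rw [← ts_act_mul_s2, mul_inv_cancel, ts_act_one_s2]

lemma ts_image_mul (g h : GG) (S : Set (ℙ L (Fin 2 → L))) :
    actGL2 L (g * h) '' S = actGL2 L g '' (actGL2 L h '' S) := by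
  rw [Set.image_image]
  exact Set.image_congr fun P _ => ts_act_mul_s2 g h P

lemma ts_image_one (S : Set (ℙ L (Fin 2 → L))) : actGL2 L (1 : GG) '' S = S := by
  rw [Set.image_congr fun P _ => ts_act_one_s2 P]
  simp only [Set.image_id', Set.image_id]

/-- the linear map with matrix `!![a, b; c, d]` -/
def tsLin (a b c d : L) : (Fin 2 → L) →ₗ[L] (Fin 2 → L) where
  toFun v := ![a * v 0 + b * v 1, c * v 0 + d * v 1]
  map_add' v w := by
    ext i; fin_cases i <;> simp <;> ring
  map_smul' r v := by
    ext i; fin_cases i <;> simp <;> ring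

lemma ts_lin_comp (a b c d D : L) (hD : D ≠ 0) (e : a * d - b * c = D) :
    tsLin a b c d * tsLin (d / D) (-b / D) (-c / D) (a / D) = 1 := by
  apply LinearMap.ext; intro v
  ext i; fin_cases i
  · simp [tsLin]; field_simp; linear_combination v 0 * e
  · simp [tsLin]; field_simp; linear_combination v 1 * e

lemma ts_lin_comp' (a b c d D : L) (hD : D ≠ 0) (e : a * d - b * c = D) :
    tsLin (d / D) (-b / D) (-c / D) (a / D) * tsLin a b c d = 1 := by
  apply LinearMap.ext; intro v
  ext i; fin_cases i
  · simp [tsLin]; field_simp; linear_combination v 0 * e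
  · simp [tsLin]; field_simp; linear_combination v 1 * e

/-- the invertible linear map with matrix `!![a, b; c, d]` -/
def tsMk (a b c d : L) (h : a * d - b * c ≠ 0) : GG where
  val := tsLin a b c d
  inv := tsLin (d / (a * d - b * c)) (-b / (a * d - b * c)) (-c / (a * d - b * c))
    (a / (a * d - b * c))
  val_inv := ts_lin_comp a b c d _ h rfl
  inv_val := ts_lin_comp' a b c d _ h rfl

lemma tsMk_apply (a b c d : L) (h : a * d - b * c ≠ 0) (v : Fin 2 → L) :
    (tsMk a b c d h).1 v = ![a * v 0 + b * v 1, c * v 0 + d * v 1] := rfl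

/-- coordinates of an arbitrary element -/
lemma ts_coord (g : GG) (v : Fin 2 → L) :
    g.1 v = ![v 0 * g.1 ![1, 0] 0 + v 1 * g.1 ![0, 1] 0,
      v 0 * g.1 ![1, 0] 1 + v 1 * g.1 ![0, 1] 1] := by
  have hv : v = v 0 • ![1, 0] + v 1 • ![0, 1] := by
    ext i; fin_cases i <;> simp
  conv_lhs => rw [hv, map_add, map_smul, map_smul]
  ext i; fin_cases i <;> simp

lemma ts_scalar_center (g : GG) (c : L) (h : ∀ v, g.1 v = c • v) :
    g ∈ Subgroup.center GG := by
  rw [Subgroup.mem_center_iff]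
  intro k
  apply Units.ext
  apply LinearMap.ext
  intro v
  change k.1 (g.1 v) = g.1 (k.1 v)
  rw [h, h, map_smul]

lemma ts_center_scalar (g : GG) (hg : g ∈ Subgroup.center GG) :
    ∃ c : L, c ≠ 0 ∧ ∀ v, g.1 v = c • v := by
  rw [Subgroup.mem_center_iff] at hg
  have h1 := hg (tsMk 1 1 0 1 (by simp))
  have h2 := hg (tsMk 1 0 1 1 (by simp))
  have e1 : ∀ v, (tsMk (L := L) 1 1 0 1 (by simp)).1 (g.1 v) =
      g.1 ((tsMk (L := L) 1 1 0 1 (by simp)).1 v) := fun v =>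
    congrArg (fun k : GG => k.1 v) h1
  have e2 : ∀ v, (tsMk (L := L) 1 0 1 1 (by simp)).1 (g.1 v) =
      g.1 ((tsMk (L := L) 1 0 1 1 (by simp)).1 v) := fun v =>
    congrArg (fun k : GG => k.1 v) h2
  have a1 := e1 ![0, 1]
  have a2 := e2 ![1, 0]
  rw [tsMk_apply, tsMk_apply] at a1 a2
  have b0 := congrFun (ts_coord g ![1, 1]) 0
  have b1 := congrFun (ts_coord g ![1, 1]) 1
  have a10 := congrFun a1 0
  have a11 := congrFun a1 1
  have a20 := congrFun a2 0
  simp at a10 a11 a20 b0 b1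
  have c1 : g.1 ![0, 1] 0 = 0 := by linear_combination -b0 - a20
  have c2 : g.1 ![1, 0] 1 = 0 := by linear_combination -b1 - a11
  have c3 : g.1 ![0, 1] 1 = g.1 ![1, 0] 0 := by linear_combination a10 + b0
  have key : ∀ v, g.1 v = (g.1 ![1, 0] 0) • v := by
    intro v
    rw [ts_coord g v]
    ext i; fin_cases i
    · simp [c1]; ring
    · simp [c2, c3]; ring
  refine ⟨_, ?_, key⟩
  intro h0
  have := ts_apply_ne g (v := ![1, 0]) (by intro hcon; simpa using congrFun hcon 0)
  rw [key, h0, zero_smul] at this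
  exact this rfl

lemma ts_scalar_act (g : GG) (c : L) (h : ∀ v, g.1 v = c • v) (P : ℙ L (Fin 2 → L)) :
    actGL2 L g P = P := by
  induction P using Projectivization.ind with
  | h v hv =>
    rw [ts_act_mk_s2, Projectivization.mk_eq_mk_iff']
    exact ⟨c, (h v).symm⟩

lemma ts_quot_eq_iff (g h : GG) :
    QuotientGroup.mk' (Subgroup.center GG) g = QuotientGroup.mk' (Subgroup.center GG) h ↔
      g⁻¹ * h ∈ Subgroup.center GG := QuotientGroup.eq

lemma ts_quot_act (g h : GG)
    (e : QuotientGroup.mk' (Subgroup.center GG) g = QuotientGroup.mk' (Subgroup.center GG) h) :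
    actGL2 L g = actGL2 L h := by
  rw [ts_quot_eq_iff] at e
  obtain ⟨c, -, hc⟩ := ts_center_scalar _ e
  funext P
  have := ts_scalar_act _ c hc P
  rw [ts_act_mul_s2] at this
  rw [← ts_act_act_inv g (actGL2 L h P), this]

lemma ts_quot_of_smul (g h : GG) (c : L) (e : ∀ v, h.1 v = c • g.1 v) :
    QuotientGroup.mk' (Subgroup.center GG) g = QuotientGroup.mk' (Subgroup.center GG) h := by
  rw [ts_quot_eq_iff]
  apply ts_scalar_center _ c
  intro v
  change (g⁻¹ : GG).1 (h.1 v) = c • v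
  rw [e, map_smul]
  congr 1
  exact congrArg (fun k : GG => k.1 v) (inv_mul_cancel g)

lemma ts_aff_ne (t : L) : (![t, 1] : Fin 2 → L) ≠ 0 := by
  intro hcon; simpa using congrFun hcon 1

/-- the affine point `[(t,1)]` -/
def tsPt (t : L) : ℙ L (Fin 2 → L) := Projectivization.mk L ![t, 1] (ts_aff_ne t)

lemma ts_pt_cases (P : ℙ L (Fin 2 → L)) (hP : P ≠ ptInf L) : ∃ t, P = tsPt t := by
  induction P using Projectivization.ind with
  | h v hv =>
    by_cases h1 : v 1 = 0
    · exfalso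
      apply hP
      rw [ptInf, Projectivization.mk_eq_mk_iff']
      refine ⟨v 0, ?_⟩
      ext i; fin_cases i <;> simp [h1]
    · refine ⟨v 0 / v 1, ?_⟩
      rw [tsPt, Projectivization.mk_eq_mk_iff']
      refine ⟨v 1, ?_⟩
      ext i; fin_cases i <;> simp
      field_simp

lemma ts_inf_mem_std : ptInf L ∈ stdSubline2 K L := by
  have e : (fun i => algebraMap K L ((![1, 0] : Fin 2 → K) i)) = ![1, 0] := by
    ext i; fin_cases i <;> simp
  refine ⟨![1, 0], ?_, ?_⟩
  · rw [e]; intro hcon; simpa using congrFun hcon 0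
  · simp only [e, ptInf]

lemma ts_pt_mem_std (t : L) : tsPt t ∈ stdSubline2 K L ↔ t ∈ Set.range (algebraMap K L) := by
  constructor
  · rintro ⟨v, hv, e⟩
    rw [tsPt, Projectivization.mk_eq_mk_iff'] at e
    obtain ⟨a, ha⟩ := e
    have h0 := congrFun ha 0
    have h1 := congrFun ha 1
    simp at h0 h1
    have : algebraMap K L (v 1) ≠ 0 := by
      intro h; rw [h] at h1; simp at h1
    refine ⟨v 0 / v 1, ?_⟩
    rw [map_div₀, ← h0]
    field_simp
    linear_combination -algebraMap K L (v 0) * h1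
  · rintro ⟨k, rfl⟩
    have e : (fun i => algebraMap K L ((![k, 1] : Fin 2 → K) i)) = ![algebraMap K L k, 1] := by
      ext i; fin_cases i <;> simp
    refine ⟨![k, 1], ?_, ?_⟩
    · rw [e]; exact ts_aff_ne _
    · simp only [e, tsPt]

lemma ts_not_std (P : ℙ L (Fin 2 → L)) (hP : P ∉ stdSubline2 K L) :
    ∃ t, t ∉ Set.range (algebraMap K L) ∧ P = tsPt t := by
  obtain ⟨t, rfl⟩ := ts_pt_cases P (fun h => hP (h ▸ ts_inf_mem_std))
  exact ⟨t, fun h => hP ((ts_pt_mem_std t).2 h), rfl⟩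

/-- elements of degree three satisfy no quadratic equation -/
lemma ts_quad (hdim : Module.finrank K L = 3) (t : L) (ht : t ∉ Set.range (algebraMap K L))
    (a b c : K)
    (h : algebraMap K L a * t ^ 2 + algebraMap K L b * t + algebraMap K L c = 0) :
    a = 0 ∧ b = 0 ∧ c = 0 := by
  have : FiniteDimensional K L := FiniteDimensional.of_finrank_pos (by omega)
  have hi : IsIntegral K t := Algebra.IsIntegral.isIntegral t
  have hd := minpoly.degree_dvd hi
  rw [hdim, Nat.dvd_prime Nat.prime_three] at hd
  have h3 : (minpoly K t).natDegree = 3 := by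
    rcases hd with hd | hd
    · exact absurd (minpoly.natDegree_eq_one_iff.1 hd) ht
    · exact hd
  have hp : Polynomial.C a * Polynomial.X ^ 2 + Polynomial.C b * Polynomial.X +
      Polynomial.C c = 0 := by
    by_contra hne
    have h1 := Polynomial.natDegree_le_natDegree (minpoly.degree_le_of_ne_zero K t hne (by simpa using h))
    have h2 := Polynomial.natDegree_quadratic_le (a := a) (b := b) (c := c)
    omega
  refine ⟨?_, ?_, ?_⟩
  · simpa using congrArg (fun p => p.coeff 2) hp
  · simpa using congrArg (fun p => p.coeff 1) hp
  · simpa using congrArg (fun p => p.coeff 0) hp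

/-- matrices over `K` preserve the standard subline -/
lemma ts_std_image_s2 (a b c d : K)
    (h' : algebraMap K L a * algebraMap K L d - algebraMap K L b * algebraMap K L c ≠ 0) :
    actGL2 L (tsMk (algebraMap K L a) (algebraMap K L b) (algebraMap K L c)
      (algebraMap K L d) h') '' stdSubline2 K L = stdSubline2 K L := by
  have key : ∀ v : Fin 2 → K, (tsMk (algebraMap K L a) (algebraMap K L b) (algebraMap K L c)
      (algebraMap K L d) h').1 (fun i => algebraMap K L (v i)) =
      fun i => algebraMap K L (![a * v 0 + b * v 1, c * v 0 + d * v 1] i) := by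
    intro v
    rw [tsMk_apply]
    ext i; fin_cases i <;> simp
  ext P
  constructor
  · rintro ⟨Q, ⟨v, hv, rfl⟩, rfl⟩
    refine ⟨![a * v 0 + b * v 1, c * v 0 + d * v 1], ?_, ?_⟩
    · rw [← key]; exact ts_apply_ne _ hv
    · simp only [ts_act_mk_s2, key]
  · rintro ⟨v, hv, rfl⟩
    have e : (fun i => algebraMap K L (![a * (d * v 0 - b * v 1) + b * (a * v 1 - c * v 0),
        c * (d * v 0 - b * v 1) + d * (a * v 1 - c * v 0)] i)) =
        (algebraMap K L a * algebraMap K L d - algebraMap K L b * algebraMap K L c) •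
          (fun i => algebraMap K L (v i)) := by
      ext i; fin_cases i <;> simp <;> ring
    have hne : (fun i => algebraMap K L (![d * v 0 - b * v 1, a * v 1 - c * v 0] i)) ≠ 0 := by
      intro h0
      have := key ![d * v 0 - b * v 1, a * v 1 - c * v 0]
      rw [h0, map_zero] at this
      simp only [Matrix.cons_val_zero, Matrix.cons_val_one] at this
      rw [e] at this
      exact smul_ne_zero h' hv this.symm
    refine ⟨_, ⟨![d * v 0 - b * v 1, a * v 1 - c * v 0], hne, rfl⟩, ?_⟩
    rw [ts_act_mk_s2, Projectivization.mk_eq_mk_iff']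
    refine ⟨algebraMap K L a * algebraMap K L d - algebraMap K L b * algebraMap K L c, ?_⟩
    rw [key]
    simp only [Matrix.cons_val_zero, Matrix.cons_val_one]
    rw [e]

/-- `PGL(2,K)` is transitive on `L ∖ K` -/
lemma ts_trans_s2 (hdim : Module.finrank K L = 3) (s t : L)
    (hs : s ∉ Set.range (algebraMap K L)) (ht : t ∉ Set.range (algebraMap K L)) :
    ∃ k : GG, actGL2 L k '' stdSubline2 K L = stdSubline2 K L ∧
      actGL2 L k (tsPt s) = tsPt t := by
  have : FiniteDimensional K L := FiniteDimensional.of_finrank_pos (by omega)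
  have hdep : ¬ LinearIndependent K ![t * s, t, s, 1] := by
    intro h
    have := h.fintype_card_le_finrank
    rw [hdim] at this
    simp at this
  rw [Fintype.not_linearIndependent_iff] at hdep
  obtain ⟨g, hg, i, hi⟩ := hdep
  simp [Fin.sum_univ_four, Algebra.smul_def] at hg
  obtain ⟨c, hc⟩ : ∃ c, c = g 0 := ⟨_, rfl⟩
  obtain ⟨d, hd⟩ : ∃ d, d = g 1 := ⟨_, rfl⟩
  obtain ⟨a, ha⟩ : ∃ a, a = - g 2 := ⟨_, rfl⟩
  obtain ⟨b, hb⟩ : ∃ b, b = - g 3 := ⟨_, rfl⟩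
  have hne : ¬ (a = 0 ∧ b = 0 ∧ c = 0 ∧ d = 0) := by
    rintro ⟨h1, h2, h3, h4⟩
    apply hi
    rw [hc] at h3
    rw [hd] at h4
    rw [ha, neg_eq_zero] at h1
    rw [hb, neg_eq_zero] at h2
    fin_cases i
    · exact h3
    · exact h4
    · exact h1
    · exact h2
  have rel : t * (algebraMap K L c * s + algebraMap K L d) =
      algebraMap K L a * s + algebraMap K L b := by
    rw [hc, hd, ha, hb, map_neg, map_neg]
    linear_combination hg
  have lin : ∀ x y : K, algebraMap K L x * s + algebraMap K L y = 0 → x = 0 ∧ y = 0 := by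
    intro x y hxy
    exact (ts_quad hdim s hs 0 x y (by simpa using hxy)).2
  have hden : algebraMap K L c * s + algebraMap K L d ≠ 0 := by
    intro h0
    rw [h0, mul_zero] at rel
    obtain ⟨h1, h2⟩ := lin _ _ h0
    obtain ⟨h3, h4⟩ := lin _ _ rel.symm
    exact hne ⟨h3, h4, h1, h2⟩
  have hdet : a * d - b * c ≠ 0 := by
    intro h0
    have h0' : algebraMap K L a * algebraMap K L d - algebraMap K L b * algebraMap K L c = 0 := by
      rw [← map_mul, ← map_mul, ← map_sub, h0, map_zero]
    by_cases hc0 : c = 0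
    · have hd0 : d ≠ 0 := by
        rintro rfl
        simp [hc0] at hden
      have ha0 : a = 0 := by
        rw [hc0, mul_zero, sub_zero] at h0
        exact (mul_eq_zero.1 h0).resolve_right hd0
      apply ht
      refine ⟨b / d, ?_⟩
      have : algebraMap K L d ≠ 0 := by simpa using hd0
      rw [map_div₀, div_eq_iff this]
      simpa [hc0, ha0] using rel.symm
    · apply ht
      refine ⟨a / c, ?_⟩
      have : algebraMap K L c ≠ 0 := by simpa using hc0
      rw [map_div₀, div_eq_iff this]
      apply mul_right_cancel₀ hden
      linear_combination -algebraMap K L c * rel + h0'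
  have hdet' : algebraMap K L a * algebraMap K L d - algebraMap K L b * algebraMap K L c ≠ 0 := by
    rw [← map_mul, ← map_mul, ← map_sub]
    exact (map_ne_zero _).2 hdet
  refine ⟨_, ts_std_image_s2 a b c d hdet', ?_⟩
  rw [tsPt, ts_act_mk_s2, tsPt, Projectivization.mk_eq_mk_iff']
  refine ⟨algebraMap K L c * s + algebraMap K L d, ?_⟩
  rw [tsMk_apply]
  ext i; fin_cases i <;> simp
  linear_combination rel

/-- an element of the stabilizer of the standard subline fixing an outside point is a scalar -/
lemma ts_stab (hdim : Module.finrank K L = 3) (k : GG) (t : L)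
    (ht : t ∉ Set.range (algebraMap K L))
    (hk : ∀ P ∈ stdSubline2 K L, actGL2 L k P ∈ stdSubline2 K L)
    (hkt : actGL2 L k (tsPt t) = tsPt t) : k ∈ Subgroup.center GG := by
  have key : ∀ v : Fin 2 → K, (hv : (fun i => algebraMap K L (v i)) ≠ 0) →
      ∃ (r : L) (w : Fin 2 → K), r ≠ 0 ∧
        k.1 (fun i => algebraMap K L (v i)) = r • (fun i => algebraMap K L (w i)) := by
    intro v hv
    obtain ⟨w, hw, e⟩ := hk _ ⟨v, hv, rfl⟩
    rw [ts_act_mk_s2, Projectivization.mk_eq_mk_iff'] at e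
    obtain ⟨r, hr⟩ := e
    refine ⟨r, w, ?_, hr.symm⟩
    rintro rfl
    rw [zero_smul] at hr
    exact ts_apply_ne k hv hr.symm
  have e0 : (fun i => algebraMap K L ((![1, 0] : Fin 2 → K) i)) = ![1, 0] := by
    ext i; fin_cases i <;> simp
  have e1 : (fun i => algebraMap K L ((![0, 1] : Fin 2 → K) i)) = ![0, 1] := by
    ext i; fin_cases i <;> simp
  have e2 : (fun i => algebraMap K L ((![1, 1] : Fin 2 → K) i)) = ![1, 1] := by
    ext i; fin_cases i <;> simp
  obtain ⟨r, u, hr, hu⟩ := key ![1, 0] (by rw [e0]; intro h; simpa using congrFun h 0)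
  obtain ⟨s, v, hs, hv⟩ := key ![0, 1] (by rw [e1]; intro h; simpa using congrFun h 1)
  obtain ⟨n, w, hn, hw⟩ := key ![1, 1] (by rw [e2]; intro h; simpa using congrFun h 1)
  rw [e0] at hu
  rw [e1] at hv
  rw [e2] at hw
  have hu0 := congrFun hu 0
  have hu1 := congrFun hu 1
  have hv0 := congrFun hv 0
  have hv1 := congrFun hv 1
  have hw' := hw
  rw [ts_coord, hu, hv] at hw'
  have hw0 := congrFun hw' 0
  have hw1 := congrFun hw' 1
  simp at hu0 hu1 hv0 hv1 hw0 hw1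
  have hD : u 0 * v 1 - u 1 * v 0 ≠ 0 := by
    intro h0
    have h0' : algebraMap K L (u 0) * algebraMap K L (v 1) -
        algebraMap K L (u 1) * algebraMap K L (v 0) = 0 := by
      rw [← map_mul, ← map_mul, ← map_sub, h0, map_zero]
    -- the kernel vectors
    have z : ∀ x y : L, x * (r * algebraMap K L (u 0)) + y * (s * algebraMap K L (v 0)) = 0 →
        x * (r * algebraMap K L (u 1)) + y * (s * algebraMap K L (v 1)) = 0 → x = 0 ∧ y = 0 := by
      intro x y h1 h2
      by_contra hne
      have hxy : (![x, y] : Fin 2 → L) ≠ 0 := by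
        intro h
        exact hne ⟨by simpa using congrFun h 0, by simpa using congrFun h 1⟩
      apply ts_apply_ne k hxy
      rw [ts_coord, hu, hv]
      ext i; fin_cases i
      · simpa using h1
      · simpa using h2
    have z1 := (z (s * algebraMap K L (v 1)) (-(r * algebraMap K L (u 1)))
      (by linear_combination r * s * h0') (by ring)).2
    have z2 := (z (s * algebraMap K L (v 0)) (-(r * algebraMap K L (u 0)))
      (by ring) (by linear_combination -r * s * h0')).2
    have z3 := (z 1 0 (by linear_combination -z2) (by linear_combination -z1)).1
    exact one_ne_zero z3
  obtain ⟨D, hDdef⟩ : ∃ D, D = u 0 * v 1 - u 1 * v 0 := ⟨_, rfl⟩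
  rw [← hDdef] at hD
  have hDL : algebraMap K L D = algebraMap K L (u 0) * algebraMap K L (v 1) -
        algebraMap K L (u 1) * algebraMap K L (v 0) := by
    rw [hDdef, map_sub, map_mul, map_mul]
  have hD' : algebraMap K L D ≠ 0 := by simpa using hD
  obtain ⟨al, hal⟩ : ∃ al, al = (w 0 * v 1 - w 1 * v 0) / D := ⟨_, rfl⟩
  obtain ⟨be, hbe⟩ : ∃ be, be = (u 0 * w 1 - u 1 * w 0) / D := ⟨_, rfl⟩
  have hra : r = n * algebraMap K L al := by
    rw [hal, map_div₀, mul_div_assoc', eq_div_iff hD', hDL]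
    simp only [map_sub, map_mul]
    linear_combination algebraMap K L (v 1) * hw0 - algebraMap K L (v 0) * hw1
  have hsb : s = n * algebraMap K L be := by
    rw [hbe, map_div₀, mul_div_assoc', eq_div_iff hD', hDL]
    simp only [map_sub, map_mul]
    linear_combination algebraMap K L (u 0) * hw1 - algebraMap K L (u 1) * hw0
  rw [tsPt, ts_act_mk_s2, Projectivization.mk_eq_mk_iff'] at hkt
  obtain ⟨m, hm⟩ := hkt
  rw [ts_coord, hu, hv] at hm
  have hm0 := congrFun hm 0
  have hm1 := congrFun hm 1
  simp at hm0 hm1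
  rw [hra, hsb] at hm0 hm1
  have hq := ts_quad hdim t ht (al * u 1) (be * v 1 - al * u 0) (-(be * v 0)) (by
    apply mul_left_cancel₀ hn
    simp only [map_sub, map_mul, map_neg]
    linear_combination hm0 - t * hm1)
  obtain ⟨q1, q2, q3⟩ := hq
  have quadOne := congrArg (algebraMap K L) q1
  have quadTwo := congrArg (algebraMap K L) q2
  have quadThree := congrArg (algebraMap K L) q3
  simp only [map_sub, map_mul, map_neg, map_zero] at quadOne quadTwo quadThree
  apply ts_scalar_center k (r * algebraMap K L (u 0))
  intro x
  rw [ts_coord, hu, hv, hra, hsb]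
  ext i; fin_cases i
  · simp
    linear_combination -n * x 1 * quadThree
  · simp
    linear_combination n * x 0 * quadOne + n * x 1 * quadTwo

/-- simple transitivity on the sublines missing the point at infinity -/
lemma ts_simply_trans (hdim : Module.finrank K L = 3) (b₁ b₂ : Set (ℙ L (Fin 2 → L)))
    (h₁ : IsOSubline2 K L b₁) (h₂ : IsOSubline2 K L b₂)
    (n₁ : ptInf L ∉ b₁) (n₂ : ptInf L ∉ b₂) :
    ∃! x : GG ⧸ Subgroup.center GG, ∃ g : GG,
      QuotientGroup.mk' (Subgroup.center GG) g = x ∧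
        actGL2 L g (ptInf L) = ptInf L ∧ actGL2 L g '' b₁ = b₂ := by
  obtain ⟨g₁, rfl⟩ := h₁
  obtain ⟨g₂, rfl⟩ := h₂
  have m₁ : actGL2 L g₁⁻¹ (ptInf L) ∉ stdSubline2 K L := fun h =>
    n₁ ⟨_, h, ts_act_act_inv _ _⟩
  have m₂ : actGL2 L g₂⁻¹ (ptInf L) ∉ stdSubline2 K L := fun h =>
    n₂ ⟨_, h, ts_act_act_inv _ _⟩
  obtain ⟨t₁, ht₁, e₁⟩ := ts_not_std _ m₁
  obtain ⟨t₂, ht₂, e₂⟩ := ts_not_std _ m₂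
  have f₁ : actGL2 L g₁ (tsPt t₁) = ptInf L := by rw [← e₁, ts_act_act_inv]
  have f₂ : actGL2 L g₂ (tsPt t₂) = ptInf L := by rw [← e₂, ts_act_act_inv]
  obtain ⟨k, hk, hkt⟩ := ts_trans_s2 hdim t₁ t₂ ht₁ ht₂
  refine ⟨QuotientGroup.mk' (Subgroup.center GG) (g₂ * k * g₁⁻¹), ⟨_, rfl, ?_, ?_⟩, ?_⟩
  · rw [ts_act_mul_s2, ts_act_mul_s2, e₁, hkt, f₂]
  · rw [← ts_image_mul, inv_mul_cancel_right, ts_image_mul, hk]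
  · rintro _ ⟨g, rfl, hg, hgb⟩
    rw [ts_quot_eq_iff]
    obtain ⟨m, hm⟩ : ∃ m : GG, m = g₁⁻¹ * (g⁻¹ * (g₂ * k)) := ⟨_, rfl⟩
    have hginv : actGL2 L g⁻¹ (ptInf L) = ptInf L := by
      conv_lhs => rw [← hg]
      rw [ts_act_inv_act]
    have hmc : m ∈ Subgroup.center GG := by
      apply ts_stab hdim m t₁ ht₁
      · intro P hP
        have : actGL2 L m '' stdSubline2 K L = stdSubline2 K L := by
          rw [hm, ts_image_mul, ts_image_mul, ts_image_mul, hk, ← hgb, ← ts_image_mul g⁻¹ g,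
            inv_mul_cancel, ts_image_one, ← ts_image_mul, inv_mul_cancel, ts_image_one]
        rw [← this]
        exact ⟨P, hP, rfl⟩
      · rw [hm, ts_act_mul_s2, ts_act_mul_s2, ts_act_mul_s2, hkt, f₂, hginv, e₁]
    have : g⁻¹ * (g₂ * k * g₁⁻¹) = g₁ * m * g₁⁻¹ := by rw [hm]; group
    rw [this]
    exact (inferInstance : (Subgroup.center GG).Normal).conj_mem m hmc g₁

lemma ts_base (hdim : Module.finrank K L = 3) :
    ∃ b : Set (ℙ L (Fin 2 → L)), IsOSubline2 K L b ∧ ptInf L ∉ b := by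
  obtain ⟨t, ht⟩ : ∃ t : L, t ∉ Set.range (algebraMap K L) := by
    by_contra! h
    have hs : Function.Surjective (algebraMap K L) := h
    have hb : (⊥ : Subalgebra K L) = ⊤ := by
      rw [eq_top_iff]
      intro x _
      exact Algebra.mem_bot.2 (h x)
    have h1 := Subalgebra.bot_eq_top_iff_finrank_eq_one.1 hb
    omega
  have hf : actGL2 L (tsMk 0 1 1 (-t) (by simp)) (tsPt t) = ptInf L := by
    rw [tsPt, ts_act_mk_s2, ptInf, Projectivization.mk_eq_mk_iff']
    refine ⟨1, ?_⟩
    rw [tsMk_apply]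
    ext i; fin_cases i <;> simp
  refine ⟨_, ⟨tsMk 0 1 1 (-t) (by simp), rfl⟩, ?_⟩
  rintro ⟨P, hP, e⟩
  apply ht
  rw [← ts_pt_mem_std, ← ts_act_inv_act (tsMk 0 1 1 (-t) (by simp)) (tsPt t), hf, ← e,
    ts_act_inv_act]
  exact hP

/-- the stabilizer of the point at infinity has `|L| (|L| - 1)` elements -/
lemma ts_card_stab :
    Set.ncard {x : GG ⧸ Subgroup.center GG | ∃ g : GG,
      QuotientGroup.mk' (Subgroup.center GG) g = x ∧ actGL2 L g (ptInf L) = ptInf L} =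
      Nat.card L * Nat.card Lˣ := by
  let f : L × Lˣ → GG ⧸ Subgroup.center GG := fun p =>
    QuotientGroup.mk' (Subgroup.center GG) (tsMk p.2 p.1 0 1 (by simp))
  have hf : Function.Injective f := by
    rintro ⟨b, a⟩ ⟨b', a'⟩ h
    obtain ⟨c, hc0, hc⟩ := ts_center_scalar _ ((ts_quot_eq_iff _ _).1 h)
    have hc' : ∀ v, (tsMk (a' : L) b' 0 1 (by simp)).1 v =
        c • (tsMk (a : L) b 0 1 (by simp)).1 v := by
      intro v
      rw [← map_smul, ← hc v]
      exact congrArg (fun k : GG => k.1 v)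
        (mul_inv_cancel_left (tsMk (a : L) b 0 1 (by simp)) _).symm
    have x1 := hc' ![0, 1]
    have x2 := hc' ![1, 0]
    rw [tsMk_apply, tsMk_apply] at x1 x2
    have y1 := congrFun x1 0
    have y2 := congrFun x1 1
    have y3 := congrFun x2 0
    simp at y1 y2 y3
    rw [← y2] at y1 y3
    simp only [one_mul] at y1 y3
    rw [Prod.mk.injEq]
    exact ⟨y1.symm, Units.ext y3.symm⟩
  have hr : {x : GG ⧸ Subgroup.center GG | ∃ g : GG,
      QuotientGroup.mk' (Subgroup.center GG) g = x ∧ actGL2 L g (ptInf L) = ptInf L} =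
      Set.range f := by
    ext x
    constructor
    · rintro ⟨g, rfl, hg⟩
      rw [ptInf, ts_act_mk_s2, Projectivization.mk_eq_mk_iff'] at hg
      obtain ⟨p, hp⟩ := hg
      have p0 := congrFun hp 0
      have p1 := congrFun hp 1
      simp at p0 p1
      have hpne : p ≠ 0 := by
        rintro rfl
        apply ts_apply_ne g (v := ![1, 0]) (by intro hcon; simpa using congrFun hcon 0)
        rw [← hp, zero_smul]
      have hune : g.1 ![0, 1] 1 ≠ 0 := by
        intro hu
        apply ts_apply_ne g (v := ![- g.1 ![0, 1] 0, p])
          (by intro hcon; exact hpne (by simpa using congrFun hcon 1))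
        rw [ts_coord]
        ext i; fin_cases i
        · simp [← p0]; ring
        · simp [← p1, hu]
      refine ⟨(g.1 ![0, 1] 0 / g.1 ![0, 1] 1,
        Units.mk0 (p / g.1 ![0, 1] 1) (div_ne_zero hpne hune)), ?_⟩
      apply ts_quot_of_smul _ _ (g.1 ![0, 1] 1)
      intro v
      rw [ts_coord g v, tsMk_apply]
      ext i; fin_cases i
      · simp [← p0]; field_simp
      · simp [← p1]; ring
    · rintro ⟨⟨b, a⟩, rfl⟩
      refine ⟨_, rfl, ?_⟩
      rw [ptInf, ts_act_mk_s2, Projectivization.mk_eq_mk_iff']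
      refine ⟨a, ?_⟩
      rw [tsMk_apply]
      ext i; fin_cases i <;> simp
  rw [hr, ← Set.image_univ, Set.ncard_image_of_injective _ hf, Set.ncard_univ, Nat.card_prod]

/-- translations are transitive on the affine points -/
lemma ts_pts_trans (x y : ℙ L (Fin 2 → L)) (hx : x ≠ ptInf L) (hy : y ≠ ptInf L) :
    ∃ g : GG, actGL2 L g (ptInf L) = ptInf L ∧ actGL2 L g x = y := by
  obtain ⟨s, rfl⟩ := ts_pt_cases x hx
  obtain ⟨t, rfl⟩ := ts_pt_cases y hy
  refine ⟨tsMk 1 (t - s) 0 1 (by simp), ?_, ?_⟩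
  · rw [ptInf, ts_act_mk_s2, Projectivization.mk_eq_mk_iff']
    refine ⟨1, ?_⟩
    rw [tsMk_apply]
    ext i; fin_cases i <;> simp
  · rw [tsPt, tsPt, ts_act_mk_s2, Projectivization.mk_eq_mk_iff']
    refine ⟨1, ?_⟩
    rw [tsMk_apply]
    ext i; fin_cases i <;> simp

/-- the sublines missing the point at infinity correspond to the stabilizer -/
lemma ts_card_sublines (hdim : Module.finrank K L = 3) :
    Set.ncard {b : Set (ℙ L (Fin 2 → L)) | IsOSubline2 K L b ∧ ptInf L ∉ b} =
    Set.ncard {x : GG ⧸ Subgroup.center GG | ∃ g : GG,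
      QuotientGroup.mk' (Subgroup.center GG) g = x ∧ actGL2 L g (ptInf L) = ptInf L} := by
  obtain ⟨b₀, hb₀, hn₀⟩ := ts_base (K := K) (L := L) hdim
  have H : ∀ b ∈ {b : Set (ℙ L (Fin 2 → L)) | IsOSubline2 K L b ∧ ptInf L ∉ b},
      ∃ x : GG ⧸ Subgroup.center GG, ∃ g : GG,
      QuotientGroup.mk' (Subgroup.center GG) g = x ∧
        actGL2 L g (ptInf L) = ptInf L ∧ actGL2 L g '' b₀ = b := fun b hb =>
    (ts_simply_trans hdim b₀ b hb₀ hb.1 hn₀ hb.2).exists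
  choose f hf using H
  refine Set.ncard_congr f ?_ ?_ ?_
  · intro b hb
    obtain ⟨g, h1, h2, -⟩ := hf b hb
    exact ⟨g, h1, h2⟩
  · intro b b' hb hb' e
    obtain ⟨g, h1, -, h3⟩ := hf b hb
    obtain ⟨g', h1', -, h3'⟩ := hf b' hb'
    rw [← h3, ← h3', ts_quot_act g g' (by rw [h1, h1', e])]
  · rintro x ⟨g, rfl, hg⟩
    have hb : IsOSubline2 K L (actGL2 L g '' b₀) ∧ ptInf L ∉ actGL2 L g '' b₀ := by
      constructor
      · obtain ⟨g₀, rfl⟩ := hb₀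
        exact ⟨g * g₀, (ts_image_mul _ _ _).symm⟩
      · rintro ⟨P, hP, e⟩
        apply hn₀
        rw [← hg] at e
        rw [← ts_act_inv_act g (ptInf L), ← e, ts_act_inv_act]
        exact hP
    refine ⟨_, hb, ?_⟩
    exact (ts_simply_trans hdim b₀ _ hb₀ hb.1 hn₀ hb.2).unique (hf _ hb) ⟨g, rfl, hg, rfl⟩

end helpers

/-- let E be the stabilizer in PGL(2,L) of the point [(1,0)] of ℙ(L²)
(PGL(2,L) being the quotient of GL(L²) by its centre, acting via `actGL2`).
Then |E| = q³(q³−1); E is transitive on the q³ points distinct from [(1,0)]; and E is simply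
transitive on the q³(q³−1) order-q-sublines not containing [(1,0)]. -/
theorem tangent_splash_stmt_2
    (q : ℕ) (K L : Type) [Field K] [Field L] [Algebra K L] [Fintype K]
    (hK : Fintype.card K = q) (hdim : Module.finrank K L = 3) :
    -- |E| = q³(q³−1), where E is the stabilizer of [(1,0)] in PGL(2,L)
    Set.ncard {x : LinearMap.GeneralLinearGroup L (Fin 2 → L) ⧸
        Subgroup.center (LinearMap.GeneralLinearGroup L (Fin 2 → L)) |
      ∃ g : LinearMap.GeneralLinearGroup L (Fin 2 → L),
        QuotientGroup.mk' (Subgroup.center (LinearMap.GeneralLinearGroup L (Fin 2 → L))) g = x ∧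
        actGL2 L g (ptInf L) = ptInf L} = q ^ 3 * (q ^ 3 - 1) ∧
    -- there are q³ points of ℙ(L²) distinct from [(1,0)], and E is transitive on them
    Set.ncard {x : ℙ L (Fin 2 → L) | x ≠ ptInf L} = q ^ 3 ∧
    (∀ x y : ℙ L (Fin 2 → L), x ≠ ptInf L → y ≠ ptInf L →
      ∃ g : LinearMap.GeneralLinearGroup L (Fin 2 → L),
        actGL2 L g (ptInf L) = ptInf L ∧ actGL2 L g x = y) ∧
    -- there are exactly q³(q³−1) order-q-sublines of ℙ(L²) not containing [(1,0)]
    Set.ncard {b : Set (ℙ L (Fin 2 → L)) | IsOSubline2 K L b ∧ ptInf L ∉ b} =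
      q ^ 3 * (q ^ 3 - 1) ∧
    -- E acts simply transitively on these sublines
    (∀ b₁ b₂ : Set (ℙ L (Fin 2 → L)),
      IsOSubline2 K L b₁ → IsOSubline2 K L b₂ → ptInf L ∉ b₁ → ptInf L ∉ b₂ →
      ∃! x : LinearMap.GeneralLinearGroup L (Fin 2 → L) ⧸
          Subgroup.center (LinearMap.GeneralLinearGroup L (Fin 2 → L)),
        ∃ g : LinearMap.GeneralLinearGroup L (Fin 2 → L),
          QuotientGroup.mk' (Subgroup.center (LinearMap.GeneralLinearGroup L (Fin 2 → L))) g
              = x ∧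
          actGL2 L g (ptInf L) = ptInf L ∧ actGL2 L g '' b₁ = b₂) := by
  have : FiniteDimensional K L := FiniteDimensional.of_finrank_pos (by omega)
  have : Finite L := Module.finite_of_finite K
  have hL : Nat.card L = q ^ 3 := by
    rw [Module.natCard_eq_pow_finrank (K := K), hdim, Nat.card_eq_fintype_card, hK]
  refine ⟨?_, ?_, ts_pts_trans, ?_, ?_⟩
  · rw [ts_card_stab, Nat.card_units, hL]
  · have hc := Projectivization.card_of_finrank_two L (Fin 2 → L) (by simp)
    have : Finite (ℙ L (Fin 2 → L)) := inferInstance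
    have h2 := Set.ncard_add_ncard_compl ({ptInf L} : Set (ℙ L (Fin 2 → L)))
    rw [Set.ncard_singleton, hc, hL] at h2
    have h3 : {x : ℙ L (Fin 2 → L) | x ≠ ptInf L} = {ptInf L}ᶜ := by
      ext x; simp
    rw [h3]
    omega
  · rw [ts_card_sublines hdim, ts_card_stab, Nat.card_units, hL]
  · intro b₁ b₂ h₁ h₂ n₁ n₂
    exact ts_simply_trans hdim b₁ b₂ h₁ h₂ n₁ n₂

end
end

section
/- The q+1 points C_e := [θ⁻(e)τ] (e ∈ K) and C_∞ := [τ] of ℙ_K(L) are pairwise distinct, and the set {C_e : e ∈ K} ∪ {C_∞} is exactly the zero set in ℙ_K(L) of the quadratic form t₀y₂² − y₀y₁ − t₂y₀y₂ in the coordinates (y₀,y₁,y₂); this zero set is a nondegenerate conic. Moreover, the form t₀y₂² − y₀y₁ − t₂y₀y₂, evaluated over L, vanishes at the transversal vector R = (t₁+t₂τ−τ², t₂−τ, −1); hence the conic is a special conic of ℙ_K(L). -/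
open scoped LinearAlgebra.Projectivization
open Module

noncomputable section

/-- Evaluation of the quadratic form with coefficient vector `c`
(coefficients of y₀², y₁², y₂², y₀y₁, y₀y₂, y₁y₂) at coordinates `y` in a `K`-algebra `A`. -/
def conicEval (K A : Type*) [CommSemiring K] [CommSemiring A] [Algebra K A]
    (c : Fin 6 → K) (y : Fin 3 → A) : A :=
  algebraMap K A (c 0) * (y 0 * y 0) + algebraMap K A (c 1) * (y 1 * y 1) +
    algebraMap K A (c 2) * (y 2 * y 2) + algebraMap K A (c 3) * (y 0 * y 1) +
    algebraMap K A (c 4) * (y 0 * y 2) + algebraMap K A (c 5) * (y 1 * y 2)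

/-- The zero set in ℙ_K(L) of the quadratic form `c`, in the coordinates (y₀,y₁,y₂) given by
the basis `B` (so λ = y₀·B 0 + y₁·B 1 + y₂·B 2, i.e. λ = y₀ + y₁τ + y₂τ²). -/
def conicZeroSet (K L : Type*) [Field K] [Field L] [Algebra K L]
    (B : Basis (Fin 3) K L) (c : Fin 6 → K) : Set (ℙ K L) :=
  {P | conicEval K K c (fun i => B.repr P.rep i) = 0}

/-- No three of the points of `Z` are collinear in ℙ_K(L). -/
def NoThreeCollinear (K L : Type*) [Field K] [Field L] [Algebra K L]
    (Z : Set (ℙ K L)) : Prop :=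
  ∀ P₁ P₂ P₃ : ℙ K L, P₁ ∈ Z → P₂ ∈ Z → P₃ ∈ Z → P₁ ≠ P₂ → P₁ ≠ P₃ → P₂ ≠ P₃ →
    ∀ W : Submodule K L, finrank K W = 2 →
      ¬(P₁.submodule ≤ W ∧ P₂.submodule ≤ W ∧ P₃.submodule ≤ W)

/-- The quadratic form `c`, evaluated over `L`, vanishes at the transversal vector
R = (t₁+t₂τ−τ², t₂−τ, −1). -/
def RvanishL (K L : Type*) [Field K] [Field L] [Algebra K L] (τ : L) (t₀ t₁ t₂ : K)
    (c : Fin 6 → K) : Prop :=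
  conicEval K L c
    ![algebraMap K L t₁ + algebraMap K L t₂ * τ - τ ^ 2, algebraMap K L t₂ - τ, -1] = 0

/-- Helper: the order of `τ` is at least `q^3 - 1`. -/
lemma aux_pow_ne (K L : Type) [Field K] [Field L] [Algebra K L] [Fintype K]
    (τ : L) (B : Basis (Fin 3) K L)
    (hprim : ∀ x : L, x ≠ 0 → ∃ n : ℕ, τ ^ n = x) (k : ℕ) (hk : 0 < k)
    (h : τ ^ k = 1) : Fintype.card K ^ 3 ≤ k + 1 := by
  classical
  haveI : Module.Finite K L := Module.Finite.of_basis B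
  haveI : Finite L := Module.finite_of_finite K
  haveI : Fintype L := Fintype.ofFinite L
  have hc : Fintype.card L = Fintype.card K ^ 3 := by
    rw [Module.card_fintype B]; simp
  have hsub : (Finset.univ.erase (0 : L)) ⊆ (Finset.range k).image (fun n => τ ^ n) := by
    intro x hx
    obtain ⟨n, hn⟩ := hprim x (Finset.ne_of_mem_erase hx)
    refine Finset.mem_image.2 ⟨n % k, Finset.mem_range.2 (Nat.mod_lt _ hk), ?_⟩
    rw [← hn]
    conv_rhs => rw [← Nat.mod_add_div n k, pow_add, pow_mul, h, one_pow, mul_one]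
  have h1 := (Finset.card_le_card hsub).trans Finset.card_image_le
  rw [Finset.card_erase_of_mem (Finset.mem_univ _), Finset.card_univ, hc, Finset.card_range] at h1
  omega

/-- Helper: Vieta for the conjugates of `τ`. -/
lemma aux_vieta (q : ℕ) (K L : Type) [Field K] [Field L] [Algebra K L] [Fintype K]
    (hK : Fintype.card K = q)
    (τ : L) (t₀ t₁ t₂ : K) (B : Basis (Fin 3) K L) (hτ0 : τ ≠ 0)
    (hτ3 : τ ^ 3 = algebraMap K L t₂ * τ ^ 2 + algebraMap K L t₁ * τ + algebraMap K L t₀)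
    (hprim : ∀ x : L, x ≠ 0 → ∃ n : ℕ, τ ^ n = x) :
    τ ^ q + τ ^ q ^ 2 = algebraMap K L t₂ - τ ∧
    τ ^ q * τ ^ q ^ 2 = τ ^ 2 - algebraMap K L t₂ * τ - algebraMap K L t₁ := by
  have hq : 2 ≤ q := hK ▸ Fintype.one_lt_card
  have key : ∀ m, 2 ≤ m → m < q ^ 3 → τ ^ m ≠ τ := by
    intro m hm hm3 h
    have h1 : τ ^ (m - 1) = 1 := by
      apply mul_right_cancel₀ hτ0
      rw [← pow_succ, one_mul, Nat.sub_add_cancel (by omega), h]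
    have := aux_pow_ne K L τ B hprim (m - 1) (by omega) h1
    rw [hK] at this
    omega
  have fr : ∀ x : L, FiniteField.frobeniusAlgHom K L x = x ^ q := by
    intro x; rw [FiniteField.coe_frobeniusAlgHom, hK]
  have root : ∀ x : L,
      x ^ 3 = algebraMap K L t₂ * x ^ 2 + algebraMap K L t₁ * x + algebraMap K L t₀ →
      (x ^ q) ^ 3 = algebraMap K L t₂ * (x ^ q) ^ 2 + algebraMap K L t₁ * (x ^ q)
        + algebraMap K L t₀ := by
    intro x hx
    have := congrArg (FiniteField.frobeniusAlgHom K L) hx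
    simp only [map_add, map_mul, map_pow, AlgHom.commutes] at this
    simpa only [fr] using this
  have hb := root τ hτ3
  have hc := root _ hb
  have e2 : (τ ^ q) ^ q = τ ^ q ^ 2 := by rw [← pow_mul, sq]
  rw [e2] at hc
  have n1 : τ ^ q ≠ τ := key q hq (by nlinarith [pow_pos (by omega : 0 < q) 2, pow_succ q 2])
  have n2 : τ ^ q ^ 2 ≠ τ := key (q ^ 2) (by nlinarith) (Nat.pow_lt_pow_right hq (by norm_num))
  have n3 : τ ^ q ^ 2 ≠ τ ^ q := by
    rw [← e2, ← fr (τ ^ q), ← fr τ]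
    intro h
    exact n1 ((fr τ).symm.trans ((FiniteField.frobeniusAlgHom K L).toRingHom.injective h))
  generalize τ ^ q = b at *
  generalize τ ^ q ^ 2 = c at *
  generalize algebraMap K L t₂ = s₂ at *
  generalize algebraMap K L t₁ = s₁ at *
  have g1 : b ^ 2 + b * τ + τ ^ 2 = s₂ * (b + τ) + s₁ := by
    apply mul_left_cancel₀ (sub_ne_zero.2 n1); linear_combination hb - hτ3
  have g2 : c ^ 2 + c * τ + τ ^ 2 = s₂ * (c + τ) + s₁ := by
    apply mul_left_cancel₀ (sub_ne_zero.2 n2); linear_combination hc - hτ3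
  have g3 : b + c = s₂ - τ := by
    apply mul_left_cancel₀ (sub_ne_zero.2 n3); linear_combination g2 - g1
  exact ⟨g3, by linear_combination b * g3 - g1⟩

lemma aux_mem (K L : Type) [Field K] [Field L] [Algebra K L] (B : Basis (Fin 3) K L)
    (t₀ t₂ : K) (v : L) (hv : v ≠ 0) :
    Projectivization.mk K v hv ∈ conicZeroSet K L B ![0, 0, t₀, -1, -t₂, 0] ↔
      t₀ * B.repr v 2 ^ 2 - B.repr v 0 * B.repr v 1 - t₂ * B.repr v 0 * B.repr v 2 = 0 := by
  obtain ⟨a, ha⟩ := Projectivization.exists_smul_eq_mk_rep K v hv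
  have : (Projectivization.mk K v hv).rep = (a : K) • v := ha.symm
  simp only [conicZeroSet, Set.mem_ofPred_eq, this, conicEval, map_smul, Finsupp.smul_apply,
    smul_eq_mul]
  have e : ∀ x y z : K, (a : K) ^ 2 * (t₀ * z ^ 2 - x * y - t₂ * x * z) = 0 ↔
      t₀ * z ^ 2 - x * y - t₂ * x * z = 0 := by
    intro x y z; simp
  rw [← e]
  apply Eq.congr_left
  simp only [Algebra.algebraMap_self, RingHom.id_apply, Matrix.cons_val]
  ring

/-- the points C_e = [θ⁻(e)τ] (e ∈ K) and C_∞ = [τ] are pairwise distinct and form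
exactly the zero set of the quadratic form t₀y₂² − y₀y₁ − t₂y₀y₂; this zero set is a
nondegenerate conic, and the form vanishes (over L) at the transversal vector R, so the conic
is special. -/
theorem tangent_splash_stmt_4
    (q : ℕ) (K L : Type) [Field K] [Field L] [Algebra K L] [Fintype K]
    (hK : Fintype.card K = q)
    (τ : L) (t₀ t₁ t₂ : K)
    (B : Basis (Fin 3) K L) (hB0 : B 0 = 1) (hB1 : B 1 = τ) (hB2 : B 2 = τ ^ 2)
    (hτ3 : τ ^ 3 = algebraMap K L t₂ * τ ^ 2 + algebraMap K L t₁ * τ + algebraMap K L t₀)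
    (hprim : ∀ x : L, x ≠ 0 → ∃ n : ℕ, τ ^ n = x)
    -- the vectors representing the points C_e (e ∈ K) and C_∞ (index `none`)
    (Cvec : Option K → L)
    (hCe : ∀ e : K, Cvec (some e) =
      (algebraMap K L e + τ ^ q) * (algebraMap K L e + τ ^ q ^ 2) * τ)
    (hCinf : Cvec none = τ)
    (hC0 : ∀ i : Option K, Cvec i ≠ 0) :
    -- the q+1 points are pairwise distinct
    Function.Injective (fun i : Option K => Projectivization.mk K (Cvec i) (hC0 i)) ∧
    -- they are exactly the zero set of the form t₀y₂² − y₀y₁ − t₂y₀y₂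
    Set.range (fun i : Option K => Projectivization.mk K (Cvec i) (hC0 i)) =
      conicZeroSet K L B ![0, 0, t₀, -1, -t₂, 0] ∧
    -- this zero set is a nondegenerate conic: q+1 points, no three collinear
    (conicZeroSet K L B ![0, 0, t₀, -1, -t₂, 0]).ncard = q + 1 ∧
    NoThreeCollinear K L (conicZeroSet K L B ![0, 0, t₀, -1, -t₂, 0]) ∧
    -- the form, evaluated over L, vanishes at the transversal vector R
    RvanishL K L τ t₀ t₁ t₂ ![0, 0, t₀, -1, -t₂, 0] := by
  have hB3 : ∀ a b c : K, algebraMap K L a + algebraMap K L b * τ + algebraMap K L c * τ ^ 2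
      = a • B 0 + b • B 1 + c • B 2 := by
    intro a b c; rw [hB0, hB1, hB2]; simp [Algebra.smul_def]
  have rep0 : ∀ a b c : K, B.repr (a • B 0 + b • B 1 + c • B 2) 0 = a := by
    intro a b c; simp [Finsupp.single_apply]
  have rep1 : ∀ a b c : K, B.repr (a • B 0 + b • B 1 + c • B 2) 1 = b := by
    intro a b c; simp [Finsupp.single_apply]
  have rep2 : ∀ a b c : K, B.repr (a • B 0 + b • B 1 + c • B 2) 2 = c := by
    intro a b c; simp [Finsupp.single_apply]
  have hτ0 : τ ≠ 0 := hB1 ▸ B.ne_zero 1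
  have ht0 : t₀ ≠ 0 := by
    rintro rfl
    have h1 : τ ^ 2 = algebraMap K L t₂ * τ + algebraMap K L t₁ := by
      apply mul_right_cancel₀ hτ0
      rw [map_zero] at hτ3
      linear_combination hτ3
    have h2 : t₁ • B 0 + t₂ • B 1 + (-1 : K) • B 2 = 0 := by
      rw [← hB3, h1]; simp; ring
    have h3 := rep2 t₁ t₂ (-1)
    rw [h2] at h3
    simp at h3
  obtain ⟨hs, hp⟩ := aux_vieta q K L hK τ t₀ t₁ t₂ B hτ0 hτ3 hprim
  have hsome : ∀ e : K, Cvec (some e) = t₀ • B 0 + (e ^ 2 + e * t₂) • B 1 + (-e) • B 2 := by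
    intro e
    rw [← hB3, hCe]
    simp only [map_add, map_mul, map_pow, map_neg]
    linear_combination (algebraMap K L e * τ) * hs + τ * hp + hτ3
  have hnone : Cvec none = (0 : K) • B 0 + (1 : K) • B 1 + (0 : K) • B 2 := by
    rw [hCinf, hB1]; simp
  have hinj : Function.Injective (fun i : Option K => Projectivization.mk K (Cvec i) (hC0 i)) := by
    intro i j hij
    obtain ⟨a, ha⟩ := (Projectivization.mk_eq_mk_iff' K _ _ _ _).1 hij
    have c0 := congrArg (fun v => B.repr v 0) ha
    have c2 := congrArg (fun v => B.repr v 2) ha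
    simp only [map_smul, Finsupp.smul_apply, smul_eq_mul] at c0 c2
    rcases i with _ | e <;> rcases j with _ | f
    · rfl
    · simp only [hsome, hnone, rep0, rep2] at c0 c2
      have : a = 0 := by simpa [ht0] using c0
      rw [this, zero_smul] at ha
      exact absurd ha.symm (hC0 _)
    · simp only [hsome, hnone, rep0, rep2] at c0 c2
      simp at c0
      exact absurd c0.symm ht0
    · simp only [hsome, rep0, rep2] at c0 c2
      have : a = 1 := by simpa [ht0] using c0
      rw [this] at c2
      simp at c2
      rw [c2]
  have hrange : Set.range (fun i : Option K => Projectivization.mk K (Cvec i) (hC0 i)) =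
      conicZeroSet K L B ![0, 0, t₀, -1, -t₂, 0] := by
    ext P
    constructor
    · rintro ⟨i, rfl⟩
      refine (aux_mem K L B t₀ t₂ _ _).2 ?_
      rcases i with _ | e
      · simp only [hnone, rep0, rep1, rep2]; ring
      · simp only [hsome, rep0, rep1, rep2]; ring
    · induction P using Projectivization.ind with
      | h v hv =>
      intro hP
      rw [aux_mem] at hP
      have hvs : v = B.repr v 0 • B 0 + B.repr v 1 • B 1 + B.repr v 2 • B 2 := by
        conv_lhs => rw [← B.sum_repr v]
        rw [Fin.sum_univ_three]
      generalize B.repr v 0 = x at *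
      generalize B.repr v 1 = y at *
      generalize B.repr v 2 = z at *
      by_cases hx : x = 0
      · subst hx
        have hz : z = 0 := by simpa [ht0] using hP
        subst hz
        refine ⟨none, ?_⟩
        refine (Projectivization.mk_eq_mk_iff' K _ _ _ _).2 ⟨y⁻¹, ?_⟩
        have hy : y ≠ 0 := by
          rintro rfl
          apply hv; rw [hvs]; simp
        rw [hnone, hvs]
        simp [hy, smul_smul]
      · refine ⟨some (-t₀ * z / x), ?_⟩
        refine (Projectivization.mk_eq_mk_iff' K _ _ _ _).2 ⟨t₀ / x, ?_⟩
        rw [hsome, hvs, smul_add, smul_add, smul_smul, smul_smul, smul_smul]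
        congr 3
        · field_simp
        · field_simp
          linear_combination -hP
        · field_simp
          try ring
  refine ⟨hinj, hrange, ?_, ?_, ?_⟩
  · rw [← hrange, ← Set.image_univ, Set.ncard_image_of_injective _ hinj, Set.ncard_univ,
      Nat.card_eq_fintype_card, Fintype.card_option, hK]
  · rw [← hrange]
    rintro _ _ _ ⟨i, rfl⟩ ⟨j, rfl⟩ ⟨k, rfl⟩ hij hik hjk W hW ⟨h1, h2, h3⟩
    replace hij : i ≠ j := fun h => hij (by rw [h])
    replace hik : i ≠ k := fun h => hik (by rw [h])
    replace hjk : j ≠ k := fun h => hjk (by rw [h])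
    simp only [Projectivization.submodule_mk, Submodule.span_singleton_le_iff_mem] at h1 h2 h3
    have hWt : W < ⊤ := by
      rw [lt_top_iff_ne_top]
      rintro rfl
      rw [finrank_top, Module.finrank_eq_card_basis B] at hW
      simp at hW
    obtain ⟨f, hf0, hf⟩ := Submodule.exists_le_ker_of_lt_top W hWt
    replace h1 : f _ = 0 := hf h1
    replace h2 : f _ = 0 := hf h2
    replace h3 : f _ = 0 := hf h3
    have hfn : f (Cvec none) = f (B 1) := by rw [hnone]; simp
    have hfs : ∀ e, f (Cvec (some e)) = t₀ * f (B 0) + (e ^ 2 + e * t₂) * f (B 1)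
        - e * f (B 2) := by intro e; rw [hsome]; simp [sub_eq_add_neg]
    have hne : ¬ (f (B 0) = 0 ∧ f (B 1) = 0 ∧ f (B 2) = 0) := by
      rintro ⟨a0, a1, a2⟩
      apply hf0
      apply B.ext
      intro i
      fin_cases i
      · exact a0
      · exact a1
      · exact a2
    apply hne
    generalize f (B 0) = x at *
    generalize f (B 1) = y at *
    generalize f (B 2) = z at *
    have lin : ∀ e g : K, e ≠ g → y = 0 → t₀ * x + (e ^ 2 + e * t₂) * y - e * z = 0 →
        t₀ * x + (g ^ 2 + g * t₂) * y - g * z = 0 → x = 0 ∧ y = 0 ∧ z = 0 := by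
      rintro e g heg rfl he hg
      have hz : z = 0 := by
        apply mul_left_cancel₀ (sub_ne_zero.2 heg); linear_combination hg - he
      subst hz
      exact ⟨by simpa [ht0] using he, rfl, rfl⟩
    rcases i with _ | a <;> rcases j with _ | b <;> rcases k with _ | c <;>
      simp only [hfn, hfs, ne_eq, not_true_eq_false, Option.some.injEq] at h1 h2 h3 hij hik hjk
    · exact lin _ _ hjk h1 h2 h3
    · exact lin _ _ hik h2 h1 h3
    · exact lin _ _ hij h3 h1 h2
    · refine lin _ _ hij ?_ h1 h2
      have u1 : (a + b + t₂) * y - z = 0 := by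
        apply mul_left_cancel₀ (sub_ne_zero.2 hij); linear_combination h1 - h2
      have u2 : (a + c + t₂) * y - z = 0 := by
        apply mul_left_cancel₀ (sub_ne_zero.2 hik); linear_combination h1 - h3
      apply mul_left_cancel₀ (sub_ne_zero.2 hjk); linear_combination u1 - u2
  · simp [RvanishL, conicEval]
    linear_combination -hτ3

end
end

section
/- Fix e,d,f ∈ K. For every h ∈ K with h ≠ e, the points P_{e,d} = (e+dτ : e : e+τ) and R_{e,d,f,h} = (h+(fh−fe+d)τ : h : h+τ) of PG(2,q³) are distinct affine points, and the line of ℙ_K(L×L×K) joining their Bruck–Bose images meets the hyperplane Σ∞ in the single point represented by (((1−d+ef)τ+fτ²)θ⁻(e)θ⁻(h), τθ⁻(e)θ⁻(h), 0). Similarly, for every h ∈ K, the line of ℙ_K(L×L×K) joining the Bruck–Bose images of U_f = (1+fτ : 1 : 1) and R_{e,d,f,h} meets Σ∞ in the single point represented by (((1−d+ef)τ+fτ²)θ⁻(h), τθ⁻(h), 0). -/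
open scoped LinearAlgebra.Projectivization
open Module

noncomputable section

/-- The Bruck–Bose image in the 7-dimensional K-vector space (L × L) × K of (a representing
vector of) an affine point (α:β:γ) of PG(2,q³): the vector
(α·γ^q·γ^{q²}, β·γ^q·γ^{q²}, N_{L/K}(γ)), where N_{L/K}(γ) = γ^{1+q+q²}. -/
def bbvec (q : ℕ) (K L : Type*) [Field K] [Field L] [Algebra K L]
    (v : Fin 3 → L) : (L × L) × K :=
  ((v 0 * (v 2 ^ q * v 2 ^ q ^ 2), v 1 * (v 2 ^ q * v 2 ^ q ^ 2)), Algebra.norm K (v 2))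

/-- The hyperplane at infinity Σ∞ of ℙ_K((L × L) × K): the points with last coordinate 0. -/
def SigmaInf (K L : Type*) [Field K] [Field L] [Algebra K L] :
    Submodule K ((L × L) × K) :=
  (⊤ : Submodule K (L × L)).prod (⊥ : Submodule K K)

theorem aux_inf {K L : Type} [Field K] [Field L] [Algebra K L] (u v w : (L × L) × K) (c : K)
    (hc : c ≠ 0) (hu : u.2 ≠ 0) (hw : w.2 = 0)
    (h : v.2 • u - u.2 • v = c • w) :
    Submodule.span K {u, v} ⊓ SigmaInf K L = Submodule.span K {w} := by
  apply le_antisymm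
  · rintro x ⟨hx, hx2⟩
    obtain ⟨a, b, rfl⟩ := Submodule.mem_span_pair.1 hx
    have h0 : a * u.2 + b * v.2 = 0 := by
      have := hx2.2
      simpa using this
    rw [Submodule.mem_span_singleton]
    refine ⟨-(b / u.2) * c, ?_⟩
    have ha : a = -(b / u.2) * v.2 := by
      field_simp
      linear_combination h0
    rw [mul_smul, ← h, ha, smul_sub, smul_smul, smul_smul]
    have : -(b / u.2) * u.2 = -b := by field_simp
    rw [this, neg_smul b, sub_neg_eq_add]
  · rw [Submodule.span_singleton_le_iff_mem]
    refine ⟨Submodule.mem_span_pair.2 ⟨c⁻¹ * v.2, -(c⁻¹ * u.2), ?_⟩, ?_⟩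
    · have : w = c⁻¹ • (c • w) := by rw [smul_smul, inv_mul_cancel₀ hc, one_smul]
      rw [this, ← h, smul_sub, smul_smul, smul_smul, neg_smul, sub_eq_add_neg]
    · exact ⟨trivial, by simpa using hw⟩

theorem aux_ne {K L : Type} [Field K] [Field L] [Algebra K L] (u v w : (L × L) × K) (c : K)
    (hc : c ≠ 0) (hw : w ≠ 0)
    (h : v.2 • u - u.2 • v = c • w) :
    Submodule.span K {u} ≠ Submodule.span K {v} := by
  intro heq
  have hu : u ∈ Submodule.span K {v} := heq ▸ Submodule.mem_span_singleton_self u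
  obtain ⟨k, rfl⟩ := Submodule.mem_span_singleton.1 hu
  apply smul_ne_zero hc hw
  rw [← h, smul_smul, Prod.smul_snd, smul_eq_mul, mul_comm, sub_self]

/-- fix e,d,f ∈ K. For h ∈ K with h ≠ e, the points P_{e,d} = (e+dτ : e : e+τ) and
R_{e,d,f,h} = (h+(fh−fe+d)τ : h : h+τ) of PG(2,q³) are distinct affine points, and the line of
ℙ_K(L×L×K) joining their Bruck–Bose images meets Σ∞ exactly in the point represented by
(((1−d+ef)τ+fτ²)θ⁻(e)θ⁻(h), τθ⁻(e)θ⁻(h), 0); similarly for every h ∈ K the line joining the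
Bruck–Bose images of U_f = (1+fτ : 1 : 1) and R_{e,d,f,h} meets Σ∞ exactly in the point
represented by (((1−d+ef)τ+fτ²)θ⁻(h), τθ⁻(h), 0). -/
theorem tangent_splash_stmt_6
    (q : ℕ) (K L : Type) [Field K] [Field L] [Algebra K L] [Fintype K]
    (hK : Fintype.card K = q)
    (τ : L) (t₀ t₁ t₂ : K)
    (B : Basis (Fin 3) K L) (hB0 : B 0 = 1) (hB1 : B 1 = τ) (hB2 : B 2 = τ ^ 2)
    (hτ3 : τ ^ 3 = algebraMap K L t₂ * τ ^ 2 + algebraMap K L t₁ * τ + algebraMap K L t₀)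
    (hprim : ∀ x : L, x ≠ 0 → ∃ n : ℕ, τ ^ n = x)
    (hnorm : ∀ γ : L, algebraMap K L (Algebra.norm K γ) = γ ^ (1 + q + q ^ 2))
    (e d f : K)
    -- θ⁻(x) = (x+τ^q)(x+τ^{q²})
    (θ : K → L)
    (hθ : ∀ x : K, θ x = (algebraMap K L x + τ ^ q) * (algebraMap K L x + τ ^ q ^ 2))
    -- the representing vectors of the points P_{e,d}, R_{e,d,f,h} and U_f of PG(2,q³)
    (Pv : Fin 3 → L)
    (hPv : Pv = ![algebraMap K L e + algebraMap K L d * τ, algebraMap K L e,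
      algebraMap K L e + τ])
    (Rv : K → Fin 3 → L)
    (hRv : ∀ h : K, Rv h = ![algebraMap K L h + algebraMap K L (f * h - f * e + d) * τ,
      algebraMap K L h, algebraMap K L h + τ])
    (Uv : Fin 3 → L)
    (hUv : Uv = ![1 + algebraMap K L f * τ, 1, 1])
    -- the vectors (((1−d+ef)τ+fτ²)θ⁻(e)θ⁻(h), τθ⁻(e)θ⁻(h), 0) and
    -- (((1−d+ef)τ+fτ²)θ⁻(h), τθ⁻(h), 0)
    (w₁ w₂ : K → (L × L) × K)
    (hw₁ : ∀ h : K, w₁ h =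
      (((algebraMap K L (1 - d + e * f) * τ + algebraMap K L f * τ ^ 2) * (θ e * θ h),
        τ * (θ e * θ h)), 0))
    (hw₂ : ∀ h : K, w₂ h =
      (((algebraMap K L (1 - d + e * f) * τ + algebraMap K L f * τ ^ 2) * θ h,
        τ * θ h), 0)) :
    (∀ h : K, h ≠ e →
      -- P_{e,d} and R_{e,d,f,h} are affine (their third coordinates are nonzero) ...
      algebraMap K L e + τ ≠ 0 ∧ algebraMap K L h + τ ≠ 0 ∧
      -- ... and they are distinct points of PG(2,q³)
      Submodule.span L {Pv} ≠ Submodule.span L {Rv h} ∧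
      -- their Bruck–Bose images are distinct points of ℙ_K(L×L×K) ...
      Submodule.span K {bbvec q K L Pv} ≠ Submodule.span K {bbvec q K L (Rv h)} ∧
      -- ... and the line joining them meets Σ∞ exactly in the single point [w₁ h]
      w₁ h ≠ 0 ∧
      Submodule.span K {bbvec q K L Pv, bbvec q K L (Rv h)} ⊓ SigmaInf K L =
        Submodule.span K {w₁ h}) ∧
    (∀ h : K,
      -- the line joining the Bruck–Bose images of U_f and R_{e,d,f,h} meets Σ∞ exactly in
      -- the single point [w₂ h]
      w₂ h ≠ 0 ∧
      Submodule.span K {bbvec q K L Uv, bbvec q K L (Rv h)} ⊓ SigmaInf K L =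
        Submodule.span K {w₂ h}) := by
  subst hK
  have hτ0 : τ ≠ 0 := hB1 ▸ B.ne_zero 1
  have hne : ∀ x : K, algebraMap K L x + τ ≠ 0 := by
    intro x hx
    have h1 : x • B 0 + (1 : K) • B 1 = 0 := by
      rw [hB0, hB1, one_smul, ← Algebra.algebraMap_eq_smul_one, hx]
    have h2 := congrArg (fun y => B.repr y 1) h1
    simp at h2
  have hfin : Module.Finite K L := Module.Finite.of_basis B
  have hfr : ∀ x : K, (algebraMap K L x + τ) ^ Fintype.card K
      = algebraMap K L x + τ ^ Fintype.card K := by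
    intro x
    have := map_add (FiniteField.frobeniusAlgHom K L) (algebraMap K L x) τ
    rw [AlgHom.commutes] at this
    simpa using this
  have hfr2 : ∀ x : K, (algebraMap K L x + τ) ^ Fintype.card K ^ 2
      = algebraMap K L x + τ ^ Fintype.card K ^ 2 := by
    intro x
    rw [sq, pow_mul, pow_mul, hfr]
    have := map_add (FiniteField.frobeniusAlgHom K L) (algebraMap K L x) (τ ^ Fintype.card K)
    rw [AlgHom.commutes] at this
    simpa using this
  have hθ' : ∀ x : K, (algebraMap K L x + τ) ^ Fintype.card K *
      (algebraMap K L x + τ) ^ Fintype.card K ^ 2 = θ x := by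
    intro x
    rw [hfr, hfr2, hθ]
  have hθ0 : ∀ x, θ x ≠ 0 := by
    intro x
    rw [← hθ']
    exact mul_ne_zero (pow_ne_zero _ (hne x)) (pow_ne_zero _ (hne x))
  have hN : ∀ x, algebraMap K L (Algebra.norm K (algebraMap K L x + τ))
      = (algebraMap K L x + τ) * θ x := by
    intro x
    rw [hnorm, ← hθ', pow_add, pow_add, pow_one, mul_assoc]
  have hN0 : ∀ x, Algebra.norm K (algebraMap K L x + τ) ≠ 0 := fun x =>
    Algebra.norm_ne_zero_iff.2 (hne x)
  have hbP : bbvec (Fintype.card K) K L Pv =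
      (((algebraMap K L e + algebraMap K L d * τ) * θ e, algebraMap K L e * θ e),
        Algebra.norm K (algebraMap K L e + τ)) := by
    simp [bbvec, hPv, hθ']
  have hbR : ∀ h, bbvec (Fintype.card K) K L (Rv h) =
      (((algebraMap K L h + algebraMap K L (f * h - f * e + d) * τ) * θ h,
        algebraMap K L h * θ h), Algebra.norm K (algebraMap K L h + τ)) := by
    intro h
    simp only [bbvec, hRv, Matrix.cons_val, hθ']
  have hbU : bbvec (Fintype.card K) K L Uv = ((1 + algebraMap K L f * τ, 1), 1) := by
    simp [bbvec, hUv]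
  refine ⟨fun h hh => ?_, fun h => ?_⟩
  · have hw0 : w₁ h ≠ 0 := by
      rw [hw₁]
      intro h0
      have := congrArg (fun z => z.1.2) h0
      exact mul_ne_zero hτ0 (mul_ne_zero (hθ0 e) (hθ0 h)) this
    have hc : e - h ≠ 0 := sub_ne_zero.2 hh.symm
    have key : (bbvec (Fintype.card K) K L (Rv h)).2 • bbvec (Fintype.card K) K L Pv
        - (bbvec (Fintype.card K) K L Pv).2 • bbvec (Fintype.card K) K L (Rv h)
        = (e - h) • w₁ h := by
      rw [hbP, hbR, hw₁]
      refine Prod.ext (Prod.ext ?_ ?_) ?_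
      · simp only [Prod.fst_sub, Prod.smul_fst]
        simp only [Algebra.smul_def, hN, map_add, map_sub, map_mul,
          map_one]
        ring
      · simp only [Prod.fst_sub, Prod.snd_sub, Prod.smul_fst, Prod.smul_snd]
        simp only [Algebra.smul_def, hN,
          map_sub]
        ring
      · simp only [Prod.snd_sub, Prod.smul_snd, smul_eq_mul]
        ring
    refine ⟨hne e, hne h, ?_, aux_ne _ _ _ _ hc hw0 key, hw0,
      aux_inf _ _ _ _ hc ?_ ?_ key⟩
    · intro heq
      have hu : Pv ∈ Submodule.span L {Rv h} := heq ▸ Submodule.mem_span_singleton_self Pv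
      obtain ⟨k, hk⟩ := Submodule.mem_span_singleton.1 hu
      rw [hPv, hRv] at hk
      have h1 := congrFun hk 1
      have h2 := congrFun hk 2
      simp only [Pi.smul_apply, Matrix.cons_val, smul_eq_mul] at h1 h2
      have h3 : algebraMap K L (e - h) * τ = 0 := by
        rw [map_sub]
        linear_combination (-(algebraMap K L h + τ)) * h1 + algebraMap K L h * h2
      rcases mul_eq_zero.1 h3 with h4 | h4
      · exact hc ((map_eq_zero _).1 h4)
      · exact hτ0 h4
    · rw [hbP]; exact hN0 e
    · rw [hw₁]
  · have hw0 : w₂ h ≠ 0 := by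
      rw [hw₂]
      intro h0
      have := congrArg (fun z => z.1.2) h0
      exact mul_ne_zero hτ0 (hθ0 h) this
    refine ⟨hw0, aux_inf _ _ _ 1 one_ne_zero ?_ ?_ ?_⟩
    · rw [hbU]; exact one_ne_zero
    · rw [hw₂]
    · rw [hbU, hbR, hw₂]
      refine Prod.ext (Prod.ext ?_ ?_) ?_
      · simp only [Prod.fst_sub, Prod.smul_fst]
        simp only [Algebra.smul_def, hN, map_add, map_sub, map_mul,
          map_one]
        ring
      · simp only [Prod.fst_sub, Prod.snd_sub, Prod.smul_fst, Prod.smul_snd]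
        simp only [Algebra.smul_def, hN,
          map_one]
        ring
      · simp only [Prod.snd_sub, Prod.smul_snd, smul_eq_mul]
        ring

end
end

section
/- Fix e,d ∈ K. The q+1 vectors v_f := (((1−d+ef)τ+fτ²)θ⁻(e)², τθ⁻(e)²) for f ∈ K, together with c_e := (τθ⁻(e), 0), all lying in L×L, represent q+1 pairwise distinct points of ℙ_K(L×L), and the K-span of all these vectors is 2-dimensional; that is, these q+1 points are collinear in ℙ_K(L×L) ≅ PG(5,q). -/
open scoped LinearAlgebra.Projectivization
open Module

/-- for fixed e,d ∈ K, the q+1 vectors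
v_f := (((1−d+ef)τ+fτ²)θ⁻(e)², τθ⁻(e)²) (f ∈ K) together with c_e := (τθ⁻(e), 0) represent
q+1 pairwise distinct points of ℙ_K(L×L), and the K-span of all of them is 2-dimensional,
i.e. these q+1 points are collinear. -/
theorem tangent_splash_stmt_7
    (q : ℕ) (K L : Type) [Field K] [Field L] [Algebra K L] [Fintype K]
    (hK : Fintype.card K = q)
    (τ : L) (t₀ t₁ t₂ : K)
    (B : Basis (Fin 3) K L) (hB0 : B 0 = 1) (hB1 : B 1 = τ) (hB2 : B 2 = τ ^ 2)
    (hτ3 : τ ^ 3 = algebraMap K L t₂ * τ ^ 2 + algebraMap K L t₁ * τ + algebraMap K L t₀)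
    (hprim : ∀ x : L, x ≠ 0 → ∃ n : ℕ, τ ^ n = x)
    (e d : K)
    (v : K → L × L)
    (hv : ∀ f : K, v f =
      ((algebraMap K L (1 - d + e * f) * τ + algebraMap K L f * τ ^ 2) *
          ((algebraMap K L e + τ ^ q) * (algebraMap K L e + τ ^ q ^ 2)) ^ 2,
        τ * ((algebraMap K L e + τ ^ q) * (algebraMap K L e + τ ^ q ^ 2)) ^ 2))
    (c : L × L)
    (hc : c = (τ * ((algebraMap K L e + τ ^ q) * (algebraMap K L e + τ ^ q ^ 2)), 0)) :
    -- all the vectors are nonzero, so represent points of ℙ_K(L×L)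
    (∀ f : K, v f ≠ 0) ∧ c ≠ 0 ∧
    -- the q+1 points are pairwise distinct
    (∀ f f' : K, Submodule.span K {v f} = Submodule.span K {v f'} → f = f') ∧
    (∀ f : K, Submodule.span K {v f} ≠ Submodule.span K {c}) ∧
    -- the K-span of all the vectors is 2-dimensional: the q+1 points are collinear
    Module.finrank K (Submodule.span K (insert c (Set.range v))) = 2 := by
  have : Module.Finite K L := Module.Finite.of_basis B
  have : Finite L := Module.finite_of_finite K
  have hfr : Module.finrank K L = 3 := by simpa using Module.finrank_eq_card_basis B
  have hτ : τ ≠ 0 := hB1 ▸ B.ne_zero 1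
  have het : algebraMap K L e + τ ≠ 0 := by
    intro h
    have h1 : e • B 0 + B 1 = 0 := by rw [hB0, hB1, Algebra.smul_def, mul_one, h]
    have h2 := congrArg (fun x => B.repr x 1) h1
    simp at h2
  have hp1 : (algebraMap K L e + τ) ^ q = algebraMap K L e + τ ^ q := by
    have h := map_add (FiniteField.frobeniusAlgHom K L) (algebraMap K L e) τ
    rw [AlgHom.commutes] at h
    simpa [FiniteField.coe_frobeniusAlgHom, hK] using h
  have hp2 : (algebraMap K L e + τ) ^ q ^ 2 = algebraMap K L e + τ ^ q ^ 2 := by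
    have h := map_add (FiniteField.frobeniusAlgHom K L) (algebraMap K L e) (τ ^ q)
    rw [AlgHom.commutes] at h
    simp only [FiniteField.coe_frobeniusAlgHom, hK] at h
    rw [pow_two, pow_mul, pow_mul, hp1, h]
  have hA : (algebraMap K L e + τ ^ q) * (algebraMap K L e + τ ^ q ^ 2) ≠ 0 := by
    rw [← hp1, ← hp2]
    exact mul_ne_zero (pow_ne_zero _ het) (pow_ne_zero _ het)
  have hN : algebraMap K L (Algebra.norm K (algebraMap K L e + τ)) = (algebraMap K L e + τ) *
      ((algebraMap K L e + τ ^ q) * (algebraMap K L e + τ ^ q ^ 2)) := by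
    rw [FiniteField.algebraMap_norm_eq_prod_pow, hfr, Nat.card_eq_fintype_card, hK,
      ← hp1, ← hp2]
    simp [Finset.prod_range_succ, mul_assoc]
  generalize (algebraMap K L e + τ ^ q) * (algebraMap K L e + τ ^ q ^ 2) = A at *
  have ht : Algebra.norm K (algebraMap K L e + τ) ≠ 0 := by
    intro h
    rw [h, map_zero] at hN
    exact mul_ne_zero het hA hN.symm
  generalize Algebra.norm K (algebraMap K L e + τ) = t at *
  have hvf : ∀ f, v f = v 0 + (f * t) • c := by
    intro f
    rw [hv, hv, hc]
    ext
    · rw [Prod.fst_add, Prod.smul_fst, Algebra.smul_def]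
      simp only [map_mul, hN, map_add, map_sub,
        map_one, map_zero]
      ring
    · simp
  have hv2 : ∀ f, (v f).2 = τ * A ^ 2 := fun f => by rw [hv]
  have hs : τ * A ^ 2 ≠ 0 := mul_ne_zero hτ (pow_ne_zero _ hA)
  have hc2 : c.2 = 0 := by rw [hc]
  have hc0 : c ≠ 0 := by
    rw [hc]
    intro h
    exact mul_ne_zero hτ hA (congrArg Prod.fst h)
  have hv0 : ∀ f, v f ≠ 0 := fun f h => hs (by rw [← hv2 f, h]; rfl)
  refine ⟨hv0, hc0, ?_, ?_, ?_⟩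
  · intro f f' h
    have hm : v f ∈ Submodule.span K {v f'} := h ▸ Submodule.mem_span_singleton_self _
    obtain ⟨a, ha⟩ := Submodule.mem_span_singleton.1 hm
    have ha2 := congrArg Prod.snd ha
    rw [Prod.smul_snd, hv2, hv2] at ha2
    have ha1 : a = 1 := smul_left_injective K hs (by simpa using ha2)
    rw [ha1, one_smul, hvf f, hvf f'] at ha
    have h3 : f' * t = f * t := smul_left_injective K hc0 (add_left_cancel ha)
    exact (mul_right_cancel₀ ht h3).symm
  · intro f h
    have hm : v f ∈ Submodule.span K {c} := h ▸ Submodule.mem_span_singleton_self _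
    obtain ⟨a, ha⟩ := Submodule.mem_span_singleton.1 hm
    have ha2 := congrArg Prod.snd ha
    rw [Prod.smul_snd, hv2, hc2, smul_zero] at ha2
    exact hs ha2.symm
  · have hli : LinearIndependent K ![c, v 0] := by
      rw [LinearIndependent.pair_iff]
      intro a b hab
      have h2 := congrArg Prod.snd hab
      rw [Prod.snd_add, Prod.smul_snd, Prod.smul_snd, hv2, hc2, smul_zero, zero_add] at h2
      have hb : b = 0 := (smul_eq_zero.1 h2).resolve_right hs
      rw [hb, zero_smul, add_zero] at hab
      exact ⟨(smul_eq_zero.1 hab).resolve_right hc0, hb⟩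
    have hsp : Submodule.span K (insert c (Set.range v)) =
        Submodule.span K (Set.range ![c, v 0]) := by
      rw [Matrix.range_cons_cons_empty]
      have hcm : c ∈ Submodule.span K {c, v 0} := Submodule.subset_span (by simp)
      have hvm : v 0 ∈ Submodule.span K {c, v 0} := Submodule.subset_span (by simp)
      apply le_antisymm
      · rw [Submodule.span_le]
        rintro x (rfl | ⟨f, rfl⟩)
        · exact hcm
        · rw [SetLike.mem_coe, hvf f]
          exact add_mem hvm (Submodule.smul_mem _ _ hcm)
      · apply Submodule.span_mono
        rintro x (rfl | rfl)
        · simp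
        · simp
    rw [hsp, finrank_span_eq_card hli]
    simp
end

section
/- Fix e ∈ K. The K-span of the set {(((1−d+ef)τ+fτ²)θ⁻(e)², τθ⁻(e)²) : d,f ∈ K} ∪ {(τθ⁻(e), 0), (τθ⁻(e)², 0)} ⊆ L×L is 3-dimensional, and this 3-dimensional subspace is a cover plane of the coordinatised tangent splash: it meets S_∞ in a 2-dimensional subspace and meets S_{a+bτ} nontrivially for all a,b ∈ K. The same holds for the K-span of {((1−d+ef)τ+fτ², τ) : d,f ∈ K} ∪ {(τ, 0), (τ², 0)}. -/
open scoped LinearAlgebra.Projectivization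
open Module

noncomputable section

/-- The 3-dimensional K-subspace S_α := {(xα, x) : x ∈ L} of L × L. -/
def Ssub (K L : Type*) [Field K] [Field L] [Algebra K L] (α : L) : Submodule K (L × L) :=
  LinearMap.range ((LinearMap.mulRight K α).prod LinearMap.id)

/-- The 3-dimensional K-subspace S_∞ := {(x, 0) : x ∈ L} of L × L. -/
def Sinf (K L : Type*) [Field K] [Field L] [Algebra K L] : Submodule K (L × L) :=
  (⊤ : Submodule K L).prod (⊥ : Submodule K L)

/-- A cover plane of the coordinatised tangent splash: a 3-dimensional K-subspace of L × L
having nonzero intersection with the centre S_∞ and with each splash element S_{a+bτ}. -/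
def IsCoverPlane (K L : Type*) [Field K] [Field L] [Algebra K L] (τ : L)
    (W : Submodule K (L × L)) : Prop :=
  Module.finrank K W = 3 ∧ W ⊓ Sinf K L ≠ ⊥ ∧
    ∀ a b : K, W ⊓ Ssub K L (algebraMap K L a + algebraMap K L b * τ) ≠ ⊥

/-- The product of two subspaces is linearly equivalent to the product type. -/
def prodSubEquiv (K L : Type) [Field K] [Field L] [Algebra K L] (P Q : Submodule K L) :
    ↥(P.prod Q) ≃ₗ[K] (P × Q) where
  toFun x := (⟨x.1.1, x.2.1⟩, ⟨x.1.2, x.2.2⟩)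
  invFun y := ⟨(y.1.1, y.2.1), ⟨y.1.2, y.2.2⟩⟩
  map_add' _ _ := rfl
  map_smul' _ _ := rfl
  left_inv _ := rfl
  right_inv _ := rfl

theorem finrank_prodSub (K L : Type) [Field K] [Field L] [Algebra K L] [FiniteDimensional K L]
    (P Q : Submodule K L) : finrank K ↥(P.prod Q) = finrank K P + finrank K Q := by
  rw [(prodSubEquiv K L P Q).finrank_eq, Module.finrank_prod]

theorem key (K L : Type) [Field K] [Field L] [Algebra K L] [FiniteDimensional K L]
    (τ u v : L) (hu : u ≠ 0) (huv : LinearIndependent K ![u, v]) (W : Submodule K (L × L))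
    (hW : W = (Submodule.span K {u, v}).prod (Submodule.span K {u}))
    (c d : K) (h : u * τ = c • u + d • v) :
    (Module.finrank K W = 3 ∧ IsCoverPlane K L τ W ∧
      Module.finrank K ↥(W ⊓ Sinf K L) = 2 ∧
      ∀ a b : K, W ⊓ Ssub K L (algebraMap K L a + algebraMap K L b * τ) ≠ ⊥) := by
  have hP : finrank K (Submodule.span K {u, v}) = 2 := by
    have := finrank_span_eq_card huv
    rw [Matrix.range_cons_cons_empty] at this
    simpa using this
  have hQ : finrank K (Submodule.span K {u}) = 1 := finrank_span_singleton hu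
  have h3 : finrank K W = 3 := by rw [hW, finrank_prodSub, hP, hQ]
  have hI : finrank K ↥(W ⊓ Sinf K L) = 2 := by
    have : W ⊓ Sinf K L = (Submodule.span K {u, v}).prod ⊥ := by
      ext ⟨x, y⟩
      simp only [hW, Sinf, Submodule.mem_inf, Submodule.mem_prod, Submodule.mem_top,
        Submodule.mem_bot, true_and]
      constructor
      · rintro ⟨⟨h1, _⟩, h2⟩
        exact ⟨h1, h2⟩
      · rintro ⟨h1, rfl⟩
        exact ⟨⟨h1, zero_mem _⟩, rfl⟩
    rw [this, finrank_prodSub, hP, finrank_bot]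
  have hS : ∀ a b : K, W ⊓ Ssub K L (algebraMap K L a + algebraMap K L b * τ) ≠ ⊥ := by
    intro a b hbot
    have : (u * (algebraMap K L a + algebraMap K L b * τ), u) ∈
        W ⊓ Ssub K L (algebraMap K L a + algebraMap K L b * τ) := by
      refine ⟨?_, ⟨u, rfl⟩⟩
      rw [hW]
      refine ⟨?_, Submodule.mem_span_singleton_self u⟩
      refine Submodule.mem_span_pair.2 ?_
      refine ⟨a + b * c, b * d, ?_⟩
      simp only [Algebra.smul_def, map_add, map_mul] at h ⊢
      linear_combination (-algebraMap K L b) * h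
    rw [hbot] at this
    simp [hu] at this
  refine ⟨h3, ⟨h3, ?_, hS⟩, hI, hS⟩
  intro hbot
  rw [hbot, finrank_bot] at hI
  omega

/-- The span in the statement is a product of subspaces. -/
theorem span_eq (K L : Type) [Field K] [Field L] [Algebra K L] (u v : L)
    (S : Set (L × L)) (g : K → K → L) (hS : S = {x | ∃ d f : K, x = (g d f, u)} ∪ {(v, 0), (u, 0)})
    (hg : ∀ d f, g d f ∈ Submodule.span K {u, v}) :
    Submodule.span K S = (Submodule.span K {u, v}).prod (Submodule.span K {u}) := by
  have hu : (u, 0) ∈ Submodule.span K S := Submodule.subset_span (by simp [hS])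
  have hv : (v, 0) ∈ Submodule.span K S := Submodule.subset_span (by simp [hS])
  have h1 : ∀ x ∈ Submodule.span K {u, v}, (x, (0 : L)) ∈ Submodule.span K S := by
    intro x hx
    obtain ⟨a, b, rfl⟩ := Submodule.mem_span_pair.1 hx
    have := add_mem (Submodule.smul_mem _ a hu) (Submodule.smul_mem _ b hv)
    simpa using this
  apply le_antisymm
  · rw [Submodule.span_le, hS]
    rintro x (⟨d, f, rfl⟩ | rfl | rfl)
    · exact ⟨hg d f, Submodule.mem_span_singleton_self u⟩
    · exact ⟨Submodule.subset_span (by simp), zero_mem _⟩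
    · exact ⟨Submodule.subset_span (by simp), zero_mem _⟩
  · rintro ⟨x, y⟩ ⟨hx, hy⟩
    obtain ⟨a, rfl⟩ := Submodule.mem_span_singleton.1 hy
    have h2 : (g 0 0, u) ∈ Submodule.span K S :=
      Submodule.subset_span (by rw [hS]; exact Or.inl ⟨0, 0, rfl⟩)
    have h3 := add_mem (sub_mem (Submodule.smul_mem _ a h2)
      (Submodule.smul_mem _ a (h1 _ (hg 0 0)))) (h1 x hx)
    simpa using h3

/-- for fixed e ∈ K, the K-span of
{(((1−d+ef)τ+fτ²)θ⁻(e)², τθ⁻(e)²) : d,f ∈ K} ∪ {(τθ⁻(e),0), (τθ⁻(e)²,0)} is 3-dimensional and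
is a cover plane of the coordinatised tangent splash, meeting S_∞ in a 2-dimensional subspace
and each S_{a+bτ} nontrivially; the same holds for the K-span of
{((1−d+ef)τ+fτ², τ) : d,f ∈ K} ∪ {(τ,0), (τ²,0)}. -/
theorem tangent_splash_stmt_9
    (q : ℕ) (K L : Type) [Field K] [Field L] [Algebra K L] [Fintype K]
    (hK : Fintype.card K = q)
    (τ : L) (t₀ t₁ t₂ : K)
    (B : Basis (Fin 3) K L) (hB0 : B 0 = 1) (hB1 : B 1 = τ) (hB2 : B 2 = τ ^ 2)
    (hτ3 : τ ^ 3 = algebraMap K L t₂ * τ ^ 2 + algebraMap K L t₁ * τ + algebraMap K L t₀)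
    (hprim : ∀ x : L, x ≠ 0 → ∃ n : ℕ, τ ^ n = x)
    (e : K)
    (W Winf : Submodule K (L × L))
    (hW : W = Submodule.span K
      ({x : L × L | ∃ d f : K, x =
          ((algebraMap K L (1 - d + e * f) * τ + algebraMap K L f * τ ^ 2) *
              ((algebraMap K L e + τ ^ q) * (algebraMap K L e + τ ^ q ^ 2)) ^ 2,
            τ * ((algebraMap K L e + τ ^ q) * (algebraMap K L e + τ ^ q ^ 2)) ^ 2)} ∪
        {(τ * ((algebraMap K L e + τ ^ q) * (algebraMap K L e + τ ^ q ^ 2)), 0),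
         (τ * ((algebraMap K L e + τ ^ q) * (algebraMap K L e + τ ^ q ^ 2)) ^ 2, 0)}))
    (hWinf : Winf = Submodule.span K
      ({x : L × L | ∃ d f : K, x =
          (algebraMap K L (1 - d + e * f) * τ + algebraMap K L f * τ ^ 2, τ)} ∪
        {(τ, 0), (τ ^ 2, 0)})) :
    (Module.finrank K W = 3 ∧ IsCoverPlane K L τ W ∧
      Module.finrank K ↥(W ⊓ Sinf K L) = 2 ∧
      ∀ a b : K, W ⊓ Ssub K L (algebraMap K L a + algebraMap K L b * τ) ≠ ⊥) ∧
    (Module.finrank K Winf = 3 ∧ IsCoverPlane K L τ Winf ∧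
      Module.finrank K ↥(Winf ⊓ Sinf K L) = 2 ∧
      ∀ a b : K, Winf ⊓ Ssub K L (algebraMap K L a + algebraMap K L b * τ) ≠ ⊥) := by
  have : FiniteDimensional K L := B.finiteDimensional_of_finite
  have hfin : finrank K L = 3 := by simp [finrank_eq_card_basis B]
  have : Finite L := Module.finite_of_finite K
  have hind : ∀ a b c : K, algebraMap K L a + algebraMap K L b * τ + algebraMap K L c * τ ^ 2 = 0 →
      a = 0 ∧ b = 0 ∧ c = 0 := by
    intro a b c h
    have := Fintype.linearIndependent_iff.1 B.linearIndependent ![a, b, c]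
      (by simpa [Fin.sum_univ_three, hB0, hB1, hB2, Algebra.smul_def] using h)
    exact ⟨this 0, this 1, this 2⟩
  have hτ : τ ≠ 0 := hB1 ▸ B.ne_zero 1
  have heτ : algebraMap K L e + τ ≠ 0 := by
    intro h
    have := hind e 1 0 (by simpa using h)
    simp at this
  obtain ⟨N, hN0', hN⟩ : ∃ N : K, N ≠ 0 ∧ algebraMap K L N = (algebraMap K L e + τ) *
      ((algebraMap K L e + τ ^ q) * (algebraMap K L e + τ ^ q ^ 2)) := by
    refine ⟨Algebra.norm K (algebraMap K L e + τ), Algebra.norm_ne_zero_iff.2 heτ, ?_⟩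
    have hq : ∀ x : L, (algebraMap K L e + x) ^ q = algebraMap K L e + x ^ q := by
      intro x
      have := map_add (FiniteField.frobeniusAlgHom K L) (algebraMap K L e) x
      rw [AlgHom.commutes] at this
      simpa [hK] using this
    rw [FiniteField.algebraMap_norm_eq_prod_pow, hfin]
    simp only [Finset.prod_range_succ, Finset.prod_range_zero, Nat.card_eq_fintype_card, hK]
    rw [pow_zero, pow_one, pow_one, pow_two q, pow_mul, pow_mul, hq, hq]
    ring
  generalize ((algebraMap K L e + τ ^ q) * (algebraMap K L e + τ ^ q ^ 2)) = θ at *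
  have hN0 : algebraMap K L N ≠ 0 := by simpa using hN0'
  have hθ0 : θ ≠ 0 := by
    rintro rfl
    simp at hN
    exact hN0' hN
  constructor
  · refine key K L τ (τ * θ ^ 2) (τ * θ) (mul_ne_zero hτ (pow_ne_zero 2 hθ0)) ?_ W ?_ (-e) N ?_
    · rw [LinearIndependent.pair_iff]
      intro s t h
      rw [Algebra.smul_def, Algebra.smul_def] at h
      have h2 : algebraMap K L (s * N + t * e) + algebraMap K L t * τ = 0 := by
        have h3 : (τ * θ) * (algebraMap K L s * θ + algebraMap K L t) = 0 := by
          linear_combination h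
        have h4 := (mul_eq_zero.1 h3).resolve_left (mul_ne_zero hτ hθ0)
        simp only [map_add, map_mul]
        linear_combination (algebraMap K L e + τ) * h4 + algebraMap K L s * hN
      have h5 := hind (s * N + t * e) t 0 (by rw [map_zero, zero_mul, add_zero]; exact h2)
      obtain ⟨h6, rfl, -⟩ := h5
      simpa [hN0'] using h6
    · rw [hW]
      refine span_eq K L _ _ _ (fun d f => (algebraMap K L (1 - d + e * f) * τ +
        algebraMap K L f * τ ^ 2) * θ ^ 2) rfl ?_
      intro d f
      rw [Submodule.mem_span_pair]
      refine ⟨1 - d, f * N, ?_⟩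
      simp only [Algebra.smul_def, map_add, map_mul, map_sub, map_one, hN]
      ring
    · simp only [Algebra.smul_def, map_neg, hN]
      ring
  · refine key K L τ τ (τ ^ 2) hτ ?_ Winf ?_ 0 1 ?_
    · rw [LinearIndependent.pair_iff]
      intro s t h
      rw [Algebra.smul_def, Algebra.smul_def] at h
      exact (hind 0 s t (by simpa using h)).2
    · rw [hWinf]
      refine span_eq K L _ _ _ (fun d f => algebraMap K L (1 - d + e * f) * τ +
        algebraMap K L f * τ ^ 2) (by rw [Set.pair_comm]) ?_
      intro d f
      rw [Submodule.mem_span_pair]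
      exact ⟨1 - d + e * f, f, by simp only [Algebra.smul_def]⟩
    · simp [pow_two]

end
end
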